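/- Let P = ∂_t − L with L periodic with period (l_1,…,l_N), and let f be periodic with period (l_1,…,l_{N+1}). If u is a bounded solution of Pu = f on ℝ^N × ℝ, then: (i) if λ_p(−L) ≥ 0 then u is periodic with period (l_1,…,l_{N+1}); (ii) if λ_p(−L) = 0 and either f ≤ 0 everywhere or f ≥ 0 everywhere, then u ≡ k φ_p for some real constant k and f ≡ 0; (iii) if λ_p(−L) > 0 and f ≡ 0 then u ≡ 0. -/

import Mathlib

open Filter Topology

noncomputable section

/-- First-order spatial partial derivative in the direction `i`. -/
def pd {N : ℕ} (i : Fin N) (φ : (Fin N → ℝ) → ℝ) (x : Fin N → ℝ) : ℝ :=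
  fderiv ℝ φ x (Pi.single i 1)

/-- Second-order spatial partial derivative `∂ᵢⱼ`. -/
def pd2 {N : ℕ} (i j : Fin N) (φ : (Fin N → ℝ) → ℝ) (x : Fin N → ℝ) : ℝ :=
  pd i (fun y => pd j φ y) x

/-- The parabolic operator `P u = ∂ₜ u − aᵢⱼ ∂ᵢⱼ u − bᵢ ∂ᵢ u − c u`. -/
def parOp {N : ℕ} (a : Fin N → Fin N → (Fin N → ℝ) → ℝ → ℝ)
    (b : Fin N → (Fin N → ℝ) → ℝ → ℝ) (c : (Fin N → ℝ) → ℝ → ℝ)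
    (u : (Fin N → ℝ) → ℝ → ℝ) (x : Fin N → ℝ) (t : ℝ) : ℝ :=
  deriv (fun s => u x s) t
    - (∑ i, ∑ j, a i j x t * pd2 i j (fun y => u y t) x)
    - (∑ i, b i x t * pd i (fun y => u y t) x)
    - c x t * u x t

/-- A bounded function on `ℝ^N × ℝ`. -/
def Bdd2 {N : ℕ} (φ : (Fin N → ℝ) → ℝ → ℝ) : Prop :=
  ∃ M : ℝ, ∀ x t, |φ x t| ≤ M

/-- A uniformly continuous function on `ℝ^N × ℝ`. -/
def UC2 {N : ℕ} (φ : (Fin N → ℝ) → ℝ → ℝ) : Prop :=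
  UniformContinuous fun p : (Fin N → ℝ) × ℝ => φ p.1 p.2

/-- Standing assumptions on the coefficients of `P`: `a`, `b` bounded and uniformly
continuous, `c` bounded and measurable, `(aᵢⱼ)` symmetric and uniformly elliptic. -/
def StdCoeffs {N : ℕ} (a : Fin N → Fin N → (Fin N → ℝ) → ℝ → ℝ)
    (b : Fin N → (Fin N → ℝ) → ℝ → ℝ) (c : (Fin N → ℝ) → ℝ → ℝ) : Prop :=
  (∀ i j, Bdd2 (a i j)) ∧ (∀ i j, UC2 (a i j)) ∧
  (∀ i, Bdd2 (b i)) ∧ (∀ i, UC2 (b i)) ∧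
  Bdd2 c ∧ Measurable (fun p : (Fin N → ℝ) × ℝ => c p.1 p.2) ∧
  (∀ i j x t, a i j x t = a j i x t) ∧
  (∃ a₀ a₁ : ℝ, 0 < a₀ ∧ a₀ ≤ a₁ ∧ ∀ (x : Fin N → ℝ) (t : ℝ) (ξ : Fin N → ℝ),
    a₀ * ∑ i, ξ i ^ 2 ≤ ∑ i, ∑ j, a i j x t * ξ i * ξ j ∧
    ∑ i, ∑ j, a i j x t * ξ i * ξ j ≤ a₁ * ∑ i, ξ i ^ 2)

/-- Regularity required of entire solutions (classical reading of the notion of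
solution used in the paper). -/
def RegSol {N : ℕ} (u : (Fin N → ℝ) → ℝ → ℝ) : Prop :=
  Continuous (fun p : (Fin N → ℝ) × ℝ => u p.1 p.2) ∧
  (∀ x, Differentiable ℝ fun s => u x s) ∧
  (∀ t, ContDiff ℝ 2 fun y => u y t)

/-- `u` is an entire solution of `P u = f` on `ℝ^N × ℝ`. -/
def IsSol {N : ℕ} (a : Fin N → Fin N → (Fin N → ℝ) → ℝ → ℝ)
    (b : Fin N → (Fin N → ℝ) → ℝ → ℝ) (c : (Fin N → ℝ) → ℝ → ℝ)
    (f u : (Fin N → ℝ) → ℝ → ℝ) : Prop :=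
  RegSol u ∧ ∀ x t, parOp a b c u x t = f x t

/-- Periodicity, with period `l`, in the `m`-th of the `N+1` space-time variables:
if `m ≤ N` this is periodicity in the space direction `x_m`, if `m = N+1` it is
periodicity in time. -/
def PerInVar {N : ℕ} (m : Fin (N + 1)) (l : ℝ) (φ : (Fin N → ℝ) → ℝ → ℝ) : Prop :=
  if h : (m : ℕ) < N then ∀ x t, φ (x + Pi.single (⟨(m : ℕ), h⟩ : Fin N) l) t = φ x t
  else ∀ x t, φ x (t + l) = φ x t
/-- Full space-time periodicity with space periods `l i` and time period `τ`. -/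
def PerAll {N : ℕ} (l : Fin N → ℝ) (τ : ℝ) (φ : (Fin N → ℝ) → ℝ → ℝ) : Prop :=
  (∀ (i : Fin N) (x : Fin N → ℝ) (t : ℝ), φ (x + Pi.single i (l i)) t = φ x t) ∧
  (∀ (x : Fin N → ℝ) (t : ℝ), φ x (t + τ) = φ x t)

/-- The elliptic operator `L φ = Aᵢⱼ ∂ᵢⱼ φ + Bᵢ ∂ᵢ φ + C φ` (time-independent
coefficients). -/
def ellOp {N : ℕ} (A : Fin N → Fin N → (Fin N → ℝ) → ℝ)
    (B : Fin N → (Fin N → ℝ) → ℝ) (C : (Fin N → ℝ) → ℝ)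
    (φ : (Fin N → ℝ) → ℝ) (x : Fin N → ℝ) : ℝ :=
  (∑ i, ∑ j, A i j x * pd2 i j φ x) + (∑ i, B i x * pd i φ x) + C x * φ x

/-- A function on `ℝ^N` periodic with period `(l 1, …, l N)`. -/
def PerSpaceFun {N : ℕ} (l : Fin N → ℝ) (ψ : (Fin N → ℝ) → ℝ) : Prop :=
  ∀ (i : Fin N) (x : Fin N → ℝ), ψ (x + Pi.single i (l i)) = ψ x

/-- `(lam, φ)` is the periodic principal eigenpair of `−L` in `ℝ^N`:
`φ` is positive, periodic (with the periods of `L`) and `−Lφ = lam • φ`. -/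
def IsPerPrincipal {N : ℕ} (A : Fin N → Fin N → (Fin N → ℝ) → ℝ)
    (B : Fin N → (Fin N → ℝ) → ℝ) (C : (Fin N → ℝ) → ℝ)
    (l : Fin N → ℝ) (lam : ℝ) (φ : (Fin N → ℝ) → ℝ) : Prop :=
  ContDiff ℝ 2 φ ∧ (∀ x, 0 < φ x) ∧ PerSpaceFun l φ ∧
  ∀ x, -(ellOp A B C φ x) = lam * φ x

/-- Squared Euclidean norm. -/
def nsq {N : ℕ} (ξ : Fin N → ℝ) : ℝ := ∑ i, ξ i ^ 2

/-- The second order operator without zeroth order term. -/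
def Lop {N : ℕ} (A : Fin N → Fin N → (Fin N → ℝ) → ℝ)
    (b : Fin N → (Fin N → ℝ) → ℝ) (g : (Fin N → ℝ) → ℝ) (x : Fin N → ℝ) : ℝ :=
  (∑ i, ∑ j, A i j x * pd2 i j g x) + ∑ i, b i x * pd i g x

lemma max1d {G G' : ℝ → ℝ} {G2 : ℝ} (h1 : ∀ᶠ s in 𝓝 (0:ℝ), HasDerivAt G (G' s) s)
    (h2 : HasDerivAt G' G2 0) (hm : ∀ᶠ s in 𝓝 (0:ℝ), G s ≤ G 0) : G' 0 = 0 ∧ G2 ≤ 0 := by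
  have hm' : IsLocalMax G 0 := hm
  have hd0 : HasDerivAt G (G' 0) 0 := h1.self_of_nhds
  have h0 : G' 0 = 0 := hm'.hasDerivAt_eq_zero hd0
  refine ⟨h0, ?_⟩
  by_contra hneg
  push Not at hneg
  have hde : deriv G =ᶠ[𝓝 0] G' := h1.mono (fun s hs => hs.deriv)
  have hdd : deriv (deriv G) 0 = G2 := by
    rw [hde.deriv_eq]; exact h2.deriv
  have hmin : IsLocalMin G 0 :=
    isLocalMin_of_deriv_deriv_pos (by rw [hdd]; exact hneg) (by rw [hd0.deriv, h0])
      hd0.continuousAt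
  have hc : G =ᶠ[𝓝 0] fun _ => G 0 := by
    filter_upwards [hm, hmin] with s h1 h2
    exact le_antisymm h1 h2
  have hc1 : deriv G =ᶠ[𝓝 0] fun _ => (0:ℝ) := by
    have := hc.deriv
    filter_upwards [this] with s hs
    rw [hs]; simp
  have : deriv (deriv G) 0 = 0 := by rw [hc1.deriv_eq]; simp
  linarith

lemma left_deriv_nonneg {F : ℝ → ℝ} {F' t : ℝ} (h : HasDerivAt F F' t)
    (hm : ∀ᶠ s in 𝓝[<] t, F s ≤ F t) : 0 ≤ F' := by
  have h1 : Tendsto (slope F t) (𝓝[<] t) (𝓝 F') :=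
    (hasDerivAt_iff_tendsto_slope.1 h).mono_left
      (nhdsWithin_mono _ (fun s hs => ne_of_lt hs))
  refine ge_of_tendsto h1 ?_
  filter_upwards [hm, self_mem_nhdsWithin] with s hs hst
  rw [slope_def_field]
  have : s < t := hst
  exact div_nonneg_of_nonpos (by linarith) (by linarith)

lemma fderiv_eq_sum_pd {N : ℕ} (g : (Fin N → ℝ) → ℝ) (p ξ : Fin N → ℝ) :
    fderiv ℝ g p ξ = ∑ i, ξ i * pd i g p := by
  conv_lhs => rw [pi_eq_sum_univ' ξ]
  rw [map_sum]
  refine Finset.sum_congr rfl (fun i _ => ?_)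
  rw [map_smul, smul_eq_mul, pd]

lemma line1 {N : ℕ} {g : (Fin N → ℝ) → ℝ} (hg : Differentiable ℝ g) (x ξ : Fin N → ℝ) (s : ℝ) :
    HasDerivAt (fun s : ℝ => g (x + s • ξ)) (∑ i, ξ i * pd i g (x + s • ξ)) s := by
  rw [← fderiv_eq_sum_pd]
  have h1 : HasDerivAt (fun s : ℝ => x + s • ξ) ξ s := by
    simpa using ((hasDerivAt_id s).smul_const ξ).const_add x
  exact (hg _).hasFDerivAt.comp_hasDerivAt s h1

lemma pd_contDiff {N : ℕ} {g : (Fin N → ℝ) → ℝ} {n : ℕ} (hg : ContDiff ℝ (n+1) g) (i : Fin N) :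
    ContDiff ℝ n (fun y => pd i g y) := by
  unfold pd
  exact (hg.fderiv_right (m := n) le_rfl).clm_apply contDiff_const

lemma pd_contDiff1 {N : ℕ} {g : (Fin N → ℝ) → ℝ} (hg : ContDiff ℝ 2 g) (i : Fin N) :
    ContDiff ℝ 1 (fun y => pd i g y) := by
  exact_mod_cast pd_contDiff (n := 1) (by exact_mod_cast hg) i

lemma line2 {N : ℕ} {g : (Fin N → ℝ) → ℝ} (hg : ContDiff ℝ 2 g) (x ξ : Fin N → ℝ) :
    HasDerivAt (fun s : ℝ => ∑ i, ξ i * pd i g (x + s • ξ))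
      (∑ i, ∑ j, ξ i * ξ j * pd2 i j g x) 0 := by
  have : ∀ i ∈ (Finset.univ : Finset (Fin N)),
      HasDerivAt (fun s : ℝ => ξ i * pd i g (x + s • ξ)) (ξ i * ∑ j, ξ j * pd2 j i g x) 0 := by
    intro i _
    have := (line1 ((pd_contDiff1 hg i).differentiable (by norm_num)) x ξ 0).const_mul (ξ i)
    simpa [pd2] using this
  have h := HasDerivAt.fun_sum this
  refine h.congr_deriv ?_
  symm
  rw [Finset.sum_comm]
  refine Finset.sum_congr rfl (fun i _ => ?_)
  rw [Finset.mul_sum]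
  refine Finset.sum_congr rfl (fun j _ => ?_)
  ring

lemma nsq_line {N : ℕ} (z ζ : Fin N → ℝ) (s : ℝ) :
    nsq (z + s • ζ) = nsq z + s * (2 * ∑ i, z i * ζ i) + s ^ 2 * nsq ζ := by
  simp only [nsq, Finset.mul_sum, ← Finset.sum_add_distrib, Pi.add_apply, Pi.smul_apply,
    smul_eq_mul]
  refine Finset.sum_congr rfl (fun i _ => ?_)
  ring

lemma nsq_nonneg {N : ℕ} (z : Fin N → ℝ) : 0 ≤ nsq z :=
  Finset.sum_nonneg (fun _ _ => sq_nonneg _)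

lemma sq_le_nsq {N : ℕ} (z : Fin N → ℝ) (i : Fin N) : z i ^ 2 ≤ nsq z :=
  Finset.single_le_sum (f := fun i => z i ^ 2) (fun _ _ => sq_nonneg _) (Finset.mem_univ i)

lemma nsq_cont {N : ℕ} : Continuous (nsq : (Fin N → ℝ) → ℝ) := by
  unfold nsq; fun_prop

lemma chi_line1 {N : ℕ} (χ χ1 : ℝ → ℝ) (z ζ : Fin N → ℝ)
    (h1 : ∀ᶠ ρ in 𝓝 (nsq z), HasDerivAt χ (χ1 ρ) ρ) :
    ∀ᶠ s in 𝓝 (0:ℝ), HasDerivAt (fun s : ℝ => χ (nsq (z + s • ζ)))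
      (χ1 (nsq (z + s • ζ)) * (2 * ∑ i, z i * ζ i + s * (2 * nsq ζ))) s := by
  have hc : Tendsto (fun s : ℝ => nsq (z + s • ζ)) (𝓝 0) (𝓝 (nsq z)) := by
    have : Continuous (fun s : ℝ => nsq (z + s • ζ)) := nsq_cont.comp (by fun_prop)
    simpa using this.tendsto 0
  filter_upwards [hc.eventually h1] with s hs
  have hq : HasDerivAt (fun s : ℝ => nsq (z + s • ζ))
      (2 * ∑ i, z i * ζ i + s * (2 * nsq ζ)) s := by
    simp only [nsq_line]
    have := (((hasDerivAt_id s).mul_const (2 * ∑ i, z i * ζ i)).const_add (nsq z)).add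
      (((hasDerivAt_id s).pow 2).mul_const (nsq ζ))
    refine this.congr_deriv ?_
    simp; ring
  exact hs.comp s hq

lemma chi_line2 {N : ℕ} (χ1 : ℝ → ℝ) (χ2 : ℝ) (z ζ : Fin N → ℝ)
    (h2 : HasDerivAt χ1 χ2 (nsq z)) :
    HasDerivAt (fun s : ℝ => χ1 (nsq (z + s • ζ)) * (2 * ∑ i, z i * ζ i + s * (2 * nsq ζ)))
      (χ2 * (2 * ∑ i, z i * ζ i) ^ 2 + 2 * χ1 (nsq z) * nsq ζ) 0 := by
  have hq : HasDerivAt (fun s : ℝ => nsq (z + s • ζ))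
      (2 * ∑ i, z i * ζ i) 0 := by
    simp only [nsq_line]
    have := (((hasDerivAt_id (0:ℝ)).mul_const (2 * ∑ i, z i * ζ i)).const_add (nsq z)).add
      (((hasDerivAt_id (0:ℝ)).pow 2).mul_const (nsq ζ))
    refine this.congr_deriv ?_
    simp
  have h2' : HasDerivAt χ1 χ2 (nsq (z + (0:ℝ) • ζ)) := by simpa using h2
  have h3 := h2'.comp 0 hq
  have h4 : HasDerivAt (fun s : ℝ => 2 * ∑ i, z i * ζ i + s * (2 * nsq ζ)) (2 * nsq ζ) 0 := by
    simpa using ((hasDerivAt_id (0:ℝ)).mul_const (2 * nsq ζ)).const_add (2 * ∑ i, z i * ζ i)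
  refine (h3.mul h4).congr_deriv ?_
  simp
  ring

open scoped MatrixOrder Matrix.Norms.L2Operator in
lemma psd_decomp {N : ℕ} (M : Fin N → Fin N → ℝ) (hs : ∀ i j, M i j = M j i)
    (hp : ∀ ξ : Fin N → ℝ, 0 ≤ ∑ i, ∑ j, M i j * ξ i * ξ j) :
    ∃ s : Fin N → Fin N → ℝ, ∀ i j, M i j = ∑ k, s k i * s k j := by
  have h : (Matrix.of M).PosSemidef := by
    refine Matrix.PosSemidef.of_dotProduct_mulVec_nonneg ?_ ?_
    · refine Matrix.IsHermitian.ext (fun i j => ?_)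
      exact hs j i
    · intro ξ
      refine (hp ξ).trans_eq ?_
      simp only [dotProduct, Matrix.mulVec, Finset.mul_sum]
      refine Finset.sum_congr rfl (fun i _ => Finset.sum_congr rfl (fun j _ => ?_))
      rw [show star ξ i = ξ i from rfl, Matrix.of_apply]
      ring
  obtain ⟨B, hB⟩ := CStarAlgebra.nonneg_iff_eq_star_mul_self.mp h.nonneg
  rw [Matrix.star_eq_conjTranspose] at hB
  refine ⟨fun k i => B k i, fun i j => ?_⟩
  have := congrFun (congrFun hB i) j
  simpa [Matrix.mul_apply] using this

/-- Sum of second derivatives along decomposition vectors. -/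
lemma sum_decomp {N : ℕ} (M : Fin N → Fin N → ℝ) (s : Fin N → Fin N → ℝ)
    (h : ∀ i j, M i j = ∑ k, s k i * s k j) (q : Fin N → Fin N → ℝ) :
    ∑ i, ∑ j, M i j * q i j = ∑ k, ∑ i, ∑ j, s k i * s k j * q i j := by
  simp only [h, Finset.sum_mul]
  rw [Finset.sum_comm' (s := Finset.univ) (t := fun _ => Finset.univ) (t' := Finset.univ)
    (s' := fun _ => Finset.univ) (by simp)]
  rw [Finset.sum_comm]
  rw [Finset.sum_comm]
  conv_rhs => rw [Finset.sum_comm]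
  rw [Finset.sum_comm]
  refine Finset.sum_congr rfl (fun i _ => ?_)
  rw [Finset.sum_comm]

lemma sum_decomp_nsq {N : ℕ} (M : Fin N → Fin N → ℝ) (s : Fin N → Fin N → ℝ)
    (h : ∀ i j, M i j = ∑ k, s k i * s k j) :
    ∑ k, nsq (s k) = ∑ i, M i i := by
  simp only [h, nsq]
  rw [Finset.sum_comm]
  refine Finset.sum_congr rfl (fun i _ => Finset.sum_congr rfl (fun j _ => by ring))

lemma sum_decomp_sq {N : ℕ} (M : Fin N → Fin N → ℝ) (s : Fin N → Fin N → ℝ)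
    (h : ∀ i j, M i j = ∑ k, s k i * s k j) (z : Fin N → ℝ) :
    ∑ k, (∑ i, z i * s k i) ^ 2 = ∑ i, ∑ j, M i j * z i * z j := by
  have := sum_decomp M s h (fun i j => z i * z j)
  simp only [← mul_assoc] at this
  rw [this]
  refine Finset.sum_congr rfl (fun k _ => ?_)
  rw [sq, Finset.sum_mul_sum]
  refine Finset.sum_congr rfl (fun i _ => Finset.sum_congr rfl (fun j _ => by ring))

lemma sum_pd_single {N : ℕ} (g : (Fin N → ℝ) → ℝ) (x : Fin N → ℝ) (i : Fin N) :
    ∑ j, (Pi.single i (1:ℝ) : Fin N → ℝ) j * pd j g x = pd i g x := by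
  simp [Pi.single_apply]

lemma touch {N : ℕ} (A : Fin N → Fin N → (Fin N → ℝ) → ℝ) (b : Fin N → (Fin N → ℝ) → ℝ)
    (hsym : ∀ i j x, A i j x = A j i x)
    (hpsd : ∀ x (ξ : Fin N → ℝ), 0 ≤ ∑ i, ∑ j, A i j x * ξ i * ξ j)
    {g : (Fin N → ℝ) → ℝ} (hg : ContDiff ℝ 2 g) (x y : Fin N → ℝ) (χ χ1 : ℝ → ℝ) (χ2 : ℝ)
    (h1 : ∀ᶠ ρ in 𝓝 (nsq (x - y)), HasDerivAt χ (χ1 ρ) ρ)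
    (h2 : HasDerivAt χ1 χ2 (nsq (x - y)))
    (hmax : ∀ᶠ x' in 𝓝 x, g x' - χ (nsq (x' - y)) ≤ g x - χ (nsq (x - y))) :
    Lop A b g x ≤ 4 * χ2 * (∑ i, ∑ j, A i j x * (x - y) i * (x - y) j)
      + 2 * χ1 (nsq (x - y)) * (∑ i, A i i x)
      + 2 * χ1 (nsq (x - y)) * ∑ i, b i x * (x - y) i := by
  have key : ∀ ξ : Fin N → ℝ,
      (∑ i, ξ i * pd i g x) = χ1 (nsq (x - y)) * (2 * ∑ i, (x - y) i * ξ i) ∧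
      (∑ i, ∑ j, ξ i * ξ j * pd2 i j g x) ≤
        χ2 * (2 * ∑ i, (x - y) i * ξ i) ^ 2 + 2 * χ1 (nsq (x - y)) * nsq ξ := by
    intro ξ
    have e1 := chi_line1 χ χ1 (x - y) ξ h1
    have e2 := chi_line2 χ1 χ2 (x - y) ξ h2
    have hc : Tendsto (fun s : ℝ => x + s • ξ) (𝓝 0) (𝓝 x) := by
      have : Continuous (fun s : ℝ => x + s • ξ) := by fun_prop
      simpa using this.tendsto 0
    have := max1d (G := fun s : ℝ => g (x + s • ξ) - χ (nsq (x - y + s • ξ)))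
      (G' := fun s => (∑ i, ξ i * pd i g (x + s • ξ)) -
        χ1 (nsq (x - y + s • ξ)) * (2 * ∑ i, (x - y) i * ξ i + s * (2 * nsq ξ)))
      (e1.mono (fun s hs => (line1 (hg.differentiable (by norm_num)) x ξ s).sub hs))
      ((line2 hg x ξ).sub e2)
      (by
        filter_upwards [hc.eventually hmax] with s hs
        have e : x + s • ξ - y = x - y + s • ξ := by abel
        rw [e] at hs
        simpa using hs)
    simp at this
    constructor
    · simp only [Pi.sub_apply] at this ⊢
      linarith [this.1]
    · simp only [Pi.sub_apply] at this ⊢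
      linarith [this.2]
  have hgrad : ∀ i, pd i g x = 2 * χ1 (nsq (x - y)) * (x - y) i := by
    intro i
    have := (key (Pi.single i 1)).1
    rw [sum_pd_single] at this
    rw [this]
    simp [Pi.single_apply]
    ring
  obtain ⟨s, hs⟩ := psd_decomp (fun i j => A i j x) (fun i j => hsym i j x) (hpsd x)
  unfold Lop
  have t1 : (∑ i, ∑ j, A i j x * pd2 i j g x) ≤ 4 * χ2 * (∑ i, ∑ j, A i j x * (x - y) i * (x - y) j)
      + 2 * χ1 (nsq (x - y)) * (∑ i, A i i x) := by
    rw [sum_decomp _ s hs, ← sum_decomp_nsq _ s hs, ← sum_decomp_sq _ s hs, Finset.mul_sum,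
      Finset.mul_sum, ← Finset.sum_add_distrib]
    refine Finset.sum_le_sum (fun k _ => ?_)
    have := (key (s k)).2
    linarith
  have t2 : ∑ i, b i x * pd i g x = 2 * χ1 (nsq (x - y)) * ∑ i, b i x * (x - y) i := by
    rw [Finset.mul_sum]
    refine Finset.sum_congr rfl (fun i _ => ?_)
    rw [hgrad]; ring
  linarith

/-- Quantitative assumptions on the coefficients. -/
structure CF {N : ℕ} (A : Fin N → Fin N → (Fin N → ℝ) → ℝ)
    (b : Fin N → (Fin N → ℝ) → ℝ) (a0 Λ β : ℝ) : Prop where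
  a0_pos : 0 < a0
  sym : ∀ i j x, A i j x = A j i x
  ell : ∀ x (ξ : Fin N → ℝ), a0 * nsq ξ ≤ ∑ i, ∑ j, A i j x * ξ i * ξ j
  Lnn : 0 ≤ Λ
  tr : ∀ x, ∑ i, A i i x ≤ Λ
  bnn : 0 ≤ β
  bb : ∀ i x, |b i x| ≤ β
  uc : ∀ ω > 0, ∃ r > 0, ∀ x y, nsq (x - y) ≤ r ^ 2 → ∀ i j, |A i j x - A i j y| ≤ ω

lemma CF.psd {N : ℕ} {A : Fin N → Fin N → (Fin N → ℝ) → ℝ}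
    {b : Fin N → (Fin N → ℝ) → ℝ} {a0 Λ β : ℝ} (h : CF A b a0 Λ β) (x ξ : Fin N → ℝ) :
    0 ≤ ∑ i, ∑ j, A i j x * ξ i * ξ j :=
  le_trans (mul_nonneg h.a0_pos.le (nsq_nonneg ξ)) (h.ell x ξ)

lemma dot_bound {N : ℕ} (c z : Fin N → ℝ) {β R : ℝ} (hc : ∀ i, |c i| ≤ β) (hβ : 0 ≤ β)
    (hR : 0 ≤ R) (hz : nsq z ≤ R ^ 2) : |∑ i, c i * z i| ≤ N * β * R := by
  refine (Finset.abs_sum_le_sum_abs _ _).trans ?_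
  have : ∀ i ∈ (Finset.univ : Finset (Fin N)), |c i * z i| ≤ β * R := by
    intro i _
    rw [abs_mul]
    refine mul_le_mul (hc i) ?_ (abs_nonneg _) hβ
    exact abs_le_of_sq_le_sq ((sq_le_nsq z i).trans hz) hR
  refine (Finset.sum_le_sum this).trans ?_
  simp [mul_assoc]

lemma nsq_compact {N : ℕ} (T : ℝ) : IsCompact {w : Fin N → ℝ | nsq w ≤ T} := by
  refine Metric.isCompact_of_isClosed_isBounded (isClosed_le nsq_cont continuous_const) ?_
  refine (Metric.isBounded_closedBall (x := (0 : Fin N → ℝ)) (r := |T| + 1)).subset ?_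
  intro w hw
  rw [mem_closedBall_zero_iff, pi_norm_le_iff_of_nonneg (by positivity)]
  intro i
  have h1 := (sq_le_nsq w i).trans hw
  have h2 : T ≤ |T| := le_abs_self T
  rw [Real.norm_eq_abs]
  refine abs_le_of_sq_le_sq ?_ (by positivity)
  nlinarith [abs_nonneg T]

lemma Lop_neg {N : ℕ} (A : Fin N → Fin N → (Fin N → ℝ) → ℝ)
    (b : Fin N → (Fin N → ℝ) → ℝ) (g : (Fin N → ℝ) → ℝ) (x : Fin N → ℝ) :
    Lop A b (fun y => - g y) x = - Lop A b g x := by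
  have h1 : ∀ (i : Fin N) (g : (Fin N → ℝ) → ℝ) (y), pd i (fun y => - g y) y = - pd i g y := by
    intro i g y
    unfold pd
    rw [fderiv_fun_neg]; rfl
  simp only [Lop, pd2, h1, mul_neg, Finset.sum_neg_distrib]
  ring

lemma liouville_pos {N : ℕ} {A : Fin N → Fin N → (Fin N → ℝ) → ℝ}
    {b : Fin N → (Fin N → ℝ) → ℝ} {a0 Λ β : ℝ} (hcf : CF A b a0 Λ β)
    {v : (Fin N → ℝ) → ℝ → ℝ} (hv : RegSol v) {K lam : ℝ} (hK : ∀ x t, |v x t| ≤ K)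
    (hlam : 0 < lam)
    (heq : ∀ x t, deriv (fun s => v x s) t = Lop A b (fun y => v y t) x - lam * v x t) :
    ∀ x t, v x t ≤ 0 := by
  intro x0 t0
  by_contra hm
  push Not at hm
  have hK0 : 0 ≤ K := (abs_nonneg _).trans (hK x0 t0)
  obtain ⟨C, hC⟩ : ∃ C, C = 2 * Λ + 2 * (N * β * √K) := ⟨_, rfl⟩
  have hC0 : 0 ≤ C := by
    rw [hC]; have := hcf.Lnn; have := hcf.bnn; positivity
  obtain ⟨δ, hδ, hδ1, hδ2⟩ : ∃ δ : ℝ, 0 < δ ∧ δ ≤ 1 ∧ δ * (C + 1) < lam * v x0 t0 := by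
    refine ⟨min 1 (lam * v x0 t0 / (2 * (C + 1))), by positivity, min_le_left _ _, ?_⟩
    have h1 : min 1 (lam * v x0 t0 / (2 * (C + 1))) ≤ lam * v x0 t0 / (2 * (C + 1)) :=
      min_le_right _ _
    calc _ ≤ lam * v x0 t0 / (2 * (C + 1)) * (C + 1) := by gcongr
      _ = lam * v x0 t0 / 2 := by field_simp
      _ < _ := by have : 0 < lam * v x0 t0 := by positivity
                  linarith
  obtain ⟨T, hT⟩ : ∃ T, T = (2 * K + 1) / δ ^ 2 := ⟨_, rfl⟩
  have hTδ : δ ^ 2 * T = 2 * K + 1 := by rw [hT]; field_simp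
  have hT0 : 0 < T := by rw [hT]; positivity
  let S : Set ((Fin N → ℝ) × ℝ) := {w | nsq w ≤ T} ×ˢ Set.Icc (t0 - T) t0
  have hS : IsCompact S := (nsq_compact T).prod isCompact_Icc
  let F : (Fin N → ℝ) × ℝ → ℝ :=
    fun p => v (p.1 + x0) p.2 - δ ^ 2 * nsq p.1 - δ ^ 2 * (t0 - p.2)
  have hFc : Continuous F := by
    have h1 : Continuous fun p : (Fin N → ℝ) × ℝ => v (p.1 + x0) p.2 :=
      hv.1.comp (f := fun p : (Fin N → ℝ) × ℝ => (p.1 + x0, p.2)) (by fun_prop)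
    have h2 : Continuous fun p : (Fin N → ℝ) × ℝ => nsq p.1 := nsq_cont.comp continuous_fst
    exact (h1.sub (h2.const_mul (δ ^ 2))).sub (by fun_prop)
  have h0S : ((0 : Fin N → ℝ), t0) ∈ S := by
    refine ⟨?_, ?_⟩
    · simp [nsq, hT0.le]
    · simp [hT0.le]
  obtain ⟨⟨w, t⟩, hwS, hmax⟩ := hS.exists_isMaxOn ⟨_, h0S⟩ hFc.continuousOn
  have hF0 : v x0 t0 ≤ F (w, t) := by
    have := hmax h0S
    simpa [F, nsq] using this
  have hwT : nsq w ≤ T := hwS.1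
  have htT : t0 - T ≤ t := hwS.2.1
  have htt : t ≤ t0 := hwS.2.2
  have hvK := (abs_le.1 (hK (w + x0) t)).2
  have hF0' : v x0 t0 ≤ v (w + x0) t - δ ^ 2 * nsq w - δ ^ 2 * (t0 - t) := hF0
  have hn1 : 0 ≤ δ ^ 2 * nsq w := mul_nonneg (by positivity) (nsq_nonneg w)
  have hn2 : 0 ≤ δ ^ 2 * (t0 - t) := mul_nonneg (by positivity) (by linarith)
  have hwK : δ ^ 2 * nsq w ≤ K := by linarith
  have htK : δ ^ 2 * (t0 - t) ≤ K := by linarith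
  have hδ2p : 0 < δ ^ 2 := by positivity
  have hwT' : nsq w < T := by nlinarith
  have htT' : t0 - T < t := by nlinarith
  -- time derivative
  have htime : 0 ≤ deriv (fun s => v (w + x0) s) t + δ ^ 2 := by
    have hd : HasDerivAt (fun s => v (w + x0) s - δ ^ 2 * nsq w - δ ^ 2 * (t0 - s))
        (deriv (fun s => v (w + x0) s) t + δ ^ 2) t := by
      have h1 := (hv.2.1 (w + x0) t).hasDerivAt
      have h2 := (((hasDerivAt_id t).const_sub t0).const_mul (δ ^ 2))
      refine ((h1.sub_const (δ ^ 2 * nsq w)).sub h2).congr_deriv ?_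
      ring
    refine left_deriv_nonneg hd ?_
    have : ∀ᶠ s in 𝓝[<] t, t0 - T < s :=
      nhdsWithin_le_nhds (eventually_gt_nhds htT')
    filter_upwards [this, self_mem_nhdsWithin] with s hs hst
    have hst' : s < t := hst
    have hm : (w, s) ∈ S := ⟨hwT, ⟨hs.le, by linarith⟩⟩
    exact hmax hm
  -- space
  have hsp := touch A b hcf.sym hcf.psd (hv.2.2 t) (w + x0) x0 (fun ρ => δ ^ 2 * ρ)
    (fun _ => δ ^ 2) 0
    (Eventually.of_forall (fun ρ => by simpa using (hasDerivAt_id ρ).const_mul (δ ^ 2)))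
    (hasDerivAt_const _ _)
    (by
      have hc : Tendsto (fun x' : Fin N → ℝ => nsq (x' - x0)) (𝓝 (w + x0)) (𝓝 (nsq w)) := by
        have : Continuous (fun x' : Fin N → ℝ => nsq (x' - x0)) := nsq_cont.comp (by fun_prop)
        simpa using this.tendsto (w + x0)
      filter_upwards [hc.eventually (eventually_lt_nhds hwT')] with x' hx'
      have hm : (x' - x0, t) ∈ S := ⟨hx'.le, hwS.2⟩
      have := hmax hm
      simp only [F, Set.mem_ofPred_eq, sub_add_cancel] at this
      simp only [add_sub_cancel_right]
      linarith)
  simp only [add_sub_cancel_right] at hsp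
  have htr := hcf.tr (w + x0)
  have hbd := dot_bound (fun i => b i (w + x0)) w (fun i => hcf.bb i _) hcf.bnn
    (Real.sqrt_nonneg (nsq w)) (Real.sq_sqrt (nsq_nonneg w)).ge
  have hbd' := (abs_le.1 hbd).2
  have hsq : δ * √(nsq w) ≤ √K := by
    apply Real.le_sqrt_of_sq_le
    rw [mul_pow, Real.sq_sqrt (nsq_nonneg w)]
    exact hwK
  have e1 : δ ^ 2 * ∑ i, A i i (w + x0) ≤ δ * Λ := by
    have h1 : δ ^ 2 * ∑ i, A i i (w + x0) ≤ δ ^ 2 * Λ := by gcongr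
    have h2 : δ ^ 2 * Λ ≤ δ * Λ := by
      apply mul_le_mul_of_nonneg_right _ hcf.Lnn
      nlinarith
    linarith
  have e2 : δ ^ 2 * ∑ i, b i (w + x0) * w i ≤ δ * (N * β * √K) := by
    have h1 : δ ^ 2 * ∑ i, b i (w + x0) * w i ≤ δ ^ 2 * (N * β * √(nsq w)) := by gcongr
    have hNb : (0:ℝ) ≤ N * β := mul_nonneg (by positivity) hcf.bnn
    have h2 : δ * (N * β) * (δ * √(nsq w)) ≤ δ * (N * β) * √K := by gcongr
    nlinarith
  have heq' := heq (w + x0) t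
  have hvm : lam * v x0 t0 ≤ lam * v (w + x0) t := by
    apply mul_le_mul_of_nonneg_left _ hlam.le
    linarith
  have hδδ : δ ^ 2 ≤ δ := by nlinarith
  rw [hC] at hδ2
  nlinarith

set_option maxHeartbeats 1000000 in
lemma propagate {N : ℕ} {A : Fin N → Fin N → (Fin N → ℝ) → ℝ}
    {b : Fin N → (Fin N → ℝ) → ℝ} {a0 Λ β : ℝ} (hcf : CF A b a0 Λ β) {r R : ℝ} (hr : 0 < r) :
    ∃ κ : ℝ, 0 ≤ κ ∧ ∀ z : (Fin N → ℝ) → ℝ → ℝ, RegSol z → (∀ x t, 0 ≤ z x t) →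
      (∀ x t, Lop A b (fun y => z y t) x ≤ deriv (fun s => z x s) t) →
      ∀ (x0 x1 : Fin N → ℝ) (t0 t1 δ : ℝ), 0 < δ → 1 ≤ t0 - t1 → nsq (x0 - x1) ≤ R ^ 2 →
      (∀ x, nsq (x - x1) ≤ r ^ 2 → δ ≤ z x t1) →
      δ * Real.exp (-(κ * (t0 - t1))) ≤ z x0 t0 := by
  have ha0 := hcf.a0_pos
  obtain ⟨c3, hc3⟩ : ∃ c3, c3 = 8 * a0 / r ^ 2 := ⟨_, rfl⟩
  have hc3p : 0 < c3 := by rw [hc3]; positivity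
  obtain ⟨C2, hC2⟩ : ∃ C2, C2 = 2 * (r ^ 2 + R ^ 2) / r ^ 2 + 4 / r ^ 2 * (Λ + N * β * r) + c3 :=
    ⟨_, rfl⟩
  refine ⟨C2 ^ 2 / c3, by positivity, ?_⟩
  obtain ⟨κ, hκ⟩ : ∃ κ, κ = C2 ^ 2 / c3 := ⟨_, rfl⟩
  rw [← hκ]
  intro z hz hznn hzeq x0 x1 t0 t1 δ hδ ht01 hxR hball
  by_contra hcon
  push Not at hcon
  obtain ⟨V, hV⟩ : ∃ V : Fin N → ℝ, V = (1 / (t0 - t1)) • (x0 - x1) := ⟨_, rfl⟩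
  have htpos : 0 < t0 - t1 := by linarith
  have hVR : nsq V ≤ R ^ 2 := by
    have h1 : nsq V = (1 / (t0 - t1)) ^ 2 * nsq (x0 - x1) := by
      rw [hV]; simp only [nsq, Pi.smul_apply, smul_eq_mul, mul_pow, Finset.mul_sum]
    rw [h1]
    have h2 : (1 / (t0 - t1)) ^ 2 ≤ 1 := by
      apply pow_le_one₀ (by positivity)
      rw [div_le_one htpos]; exact ht01
    have := nsq_nonneg (x0 - x1)
    nlinarith
  let y : ℝ → (Fin N → ℝ) := fun t => x1 + (t - t1) • V
  have hy0 : y t0 = x0 := by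
    simp only [y, hV, smul_smul]
    rw [mul_one_div_cancel htpos.ne', one_smul]; abel
  have hy1 : y t1 = x1 := by simp [y]
  have hyc : Continuous y := by fun_prop
  let S : Set ((Fin N → ℝ) × ℝ) := {w | nsq w ≤ r ^ 2} ×ˢ Set.Icc t1 t0
  have hS : IsCompact S := (nsq_compact _).prod isCompact_Icc
  let E : ℝ → ℝ := fun t => δ * Real.exp (-(κ * (t - t1)))
  have hE : ∀ t, 0 < E t := fun t => by positivity
  let F : (Fin N → ℝ) × ℝ → ℝ :=
    fun p => z (p.1 + y p.2) p.2 - E p.2 * (1 - nsq p.1 / r ^ 2) ^ 2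
  have hFc : Continuous F := by
    have h1 : Continuous fun p : (Fin N → ℝ) × ℝ => z (p.1 + y p.2) p.2 :=
      hz.1.comp (f := fun p : (Fin N → ℝ) × ℝ => (p.1 + y p.2, p.2)) (by fun_prop)
    have h2 : Continuous fun p : (Fin N → ℝ) × ℝ => nsq p.1 := nsq_cont.comp continuous_fst
    have h3 : Continuous E := by fun_prop
    have h4 : Continuous fun p : (Fin N → ℝ) × ℝ => E p.2 := h3.comp continuous_snd
    exact h1.sub (h4.mul ((continuous_const.sub (h2.div_const (r ^ 2))).pow 2))
  have h0S : ((0 : Fin N → ℝ), t0) ∈ S := by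
    refine ⟨?_, ?_⟩
    · simp [nsq]; positivity
    · simp; linarith
  obtain ⟨⟨w, t⟩, hwS, hmin⟩ := hS.exists_isMinOn ⟨_, h0S⟩ hFc.continuousOn
  have hF0 : F (w, t) < 0 := by
    have h1 : F (w, t) ≤ F (0, t0) := hmin h0S
    have h2 : F (0, t0) < 0 := by
      simp only [F, zero_add, hy0, E]
      simp [nsq]
      linarith
    linarith
  have hF0' : z (w + y t) t < E t * (1 - nsq w / r ^ 2) ^ 2 := by
    simp only [F] at hF0; linarith
  have hwr : nsq w ≤ r ^ 2 := hwS.1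
  have ht1 : t1 ≤ t := hwS.2.1
  have ht0 : t ≤ t0 := hwS.2.2
  have hr2 : 0 < r ^ 2 := by positivity
  obtain ⟨s, hs⟩ : ∃ s, s = 1 - nsq w / r ^ 2 := ⟨_, rfl⟩
  have hs0 : 0 ≤ s := by
    have : nsq w / r ^ 2 ≤ 1 := by rw [div_le_one hr2]; exact hwr
    linarith
  have hs1 : s ≤ 1 := by
    have : 0 ≤ nsq w / r ^ 2 := div_nonneg (nsq_nonneg w) hr2.le
    linarith
  have hwr' : nsq w < r ^ 2 := by
    rcases hwr.lt_or_eq with h | h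
    · exact h
    · exfalso
      rw [h, div_self hr2.ne'] at hF0'
      have := hznn (w + y t) t
      simp at hF0'
      linarith
  have ht1' : t1 < t := by
    rcases ht1.lt_or_eq with h | h
    · exact h
    · exfalso
      rw [← h, hy1] at hF0'
      have h1 := hball (w + x1) (by simpa using hwr)
      have h2 : E t1 = δ := by simp [E]
      rw [h2, ← hs] at hF0'
      have : s ^ 2 ≤ 1 := pow_le_one₀ hs0 hs1
      nlinarith
  -- time
  have htime : deriv (fun τ => z (w + y t) τ) t ≤
      E t * (-κ * s ^ 2 + 2 * s * (2 * (∑ i, w i * V i) / r ^ 2)) := by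
    have hq : HasDerivAt (fun τ : ℝ => nsq (w + (t - τ) • V)) (-(2 * ∑ i, w i * V i)) t := by
      simp only [nsq_line]
      have h0 : HasDerivAt (fun τ : ℝ => t - τ) (-1) t := by
        simpa using (hasDerivAt_id t).const_sub t
      have := ((h0.mul_const (2 * ∑ i, w i * V i)).const_add (nsq w)).add
        ((h0.pow 2).mul_const (nsq V))
      refine this.congr_deriv ?_
      simp
    have hEd : HasDerivAt E (E t * (-κ)) t := by
      have h0 : HasDerivAt (fun τ : ℝ => -(κ * (τ - t1))) (-κ) t := by
        have := (((hasDerivAt_id t).sub_const t1).const_mul κ).fun_neg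
        simpa using this
      refine (h0.exp.const_mul δ).congr_deriv ?_
      simp only [E]; ring
    have hsd : HasDerivAt (fun τ : ℝ => 1 - nsq (w + (t - τ) • V) / r ^ 2)
        ((2 * ∑ i, w i * V i) / r ^ 2) t := by
      refine ((hq.div_const (r ^ 2)).const_sub 1).congr_deriv ?_
      ring
    have h1 := (hz.2.1 (w + y t) t).hasDerivAt
    have hd := (hEd.mul (hsd.pow 2)).sub h1
    have := left_deriv_nonneg hd (by
      have e1 : ∀ᶠ τ in 𝓝[<] t, t1 < τ := nhdsWithin_le_nhds (eventually_gt_nhds ht1')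
      have hc : Tendsto (fun τ : ℝ => nsq (w + (t - τ) • V)) (𝓝 t) (𝓝 (nsq w)) := by
        have := hq.continuousAt.tendsto
        simpa using this
      have e2 : ∀ᶠ τ in 𝓝[<] t, nsq (w + (t - τ) • V) < r ^ 2 :=
        nhdsWithin_le_nhds (hc.eventually (eventually_lt_nhds hwr'))
      filter_upwards [e1, e2, self_mem_nhdsWithin] with τ h1 h2 h3
      have h3' : τ < t := h3
      have hm : (w + (t - τ) • V, τ) ∈ S := ⟨h2.le, ⟨h1.le, by linarith⟩⟩
      have h4 := hmin hm
      have h5 : w + (t - τ) • V + y τ = w + y t := by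
        simp only [y]
        ext i; simp; ring
      simp only [F, Set.mem_ofPred_eq, h5] at h4
      simp only [Pi.sub_apply, Pi.mul_apply, Pi.pow_apply, sub_self, zero_smul, add_zero]
      linarith)
    simp only [sub_self, zero_smul, add_zero, Pi.pow_apply, ← hs] at this
    simp at this
    linarith
  -- space
  have hsp := touch A b hcf.sym hcf.psd (g := fun x => - z x t) (hz.2.2 t).neg (w + y t) (y t)
    (fun ρ => - (E t * (1 - ρ / r ^ 2) ^ 2))
    (fun ρ => 2 * E t / r ^ 2 * (1 - ρ / r ^ 2)) (- (2 * E t / r ^ 4))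
    (Eventually.of_forall (fun ρ => by
      have h0 : HasDerivAt (fun ρ : ℝ => 1 - ρ / r ^ 2) (-(1 / r ^ 2)) ρ := by
        simpa using ((hasDerivAt_id ρ).div_const (r ^ 2)).const_sub 1
      refine ((h0.pow 2).const_mul (E t)).neg.congr_deriv ?_
      simp; ring))
    (by
      have h0 : ∀ ρ, HasDerivAt (fun ρ : ℝ => 1 - ρ / r ^ 2) (-(1 / r ^ 2)) ρ := fun ρ => by
        simpa using ((hasDerivAt_id ρ).div_const (r ^ 2)).const_sub 1
      refine ((h0 _).const_mul (2 * E t / r ^ 2)).congr_deriv ?_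
      field_simp)
    (by
      have hc : Tendsto (fun x' : Fin N → ℝ => nsq (x' - y t)) (𝓝 (w + y t)) (𝓝 (nsq w)) := by
        have : Continuous (fun x' : Fin N → ℝ => nsq (x' - y t)) := nsq_cont.comp (by fun_prop)
        simpa using this.tendsto (w + y t)
      filter_upwards [hc.eventually (eventually_lt_nhds hwr')] with x' hx'
      have hm : (x' - y t, t) ∈ S := ⟨hx'.le, hwS.2⟩
      have := hmin hm
      simp only [F, Set.mem_ofPred_eq, sub_add_cancel] at this
      simp only [add_sub_cancel_right]
      linarith)
  simp only [add_sub_cancel_right, ← hs] at hsp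
  rw [Lop_neg] at hsp
  have hpde := hzeq (w + y t) t
  have htr := hcf.tr (w + y t)
  have hbd := (abs_le.1 (dot_bound (fun i => b i (w + y t)) w (fun i => hcf.bb i _) hcf.bnn
    hr.le hwr)).2
  have hell := hcf.ell (w + y t) w
  have hwV : 2 * ∑ i, w i * V i ≤ r ^ 2 + R ^ 2 := by
    have : 2 * ∑ i, w i * V i ≤ nsq w + nsq V := by
      simp only [nsq, Finset.mul_sum, ← Finset.sum_add_distrib]
      refine Finset.sum_le_sum (fun i _ => ?_)
      nlinarith [sq_nonneg (w i - V i)]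
    linarith
  have hEt := hE t
  have hρ : nsq w = r ^ 2 * (1 - s) := by rw [hs]; field_simp; ring
  -- combine
  have k1 : 4 * (-(2 * E t / r ^ 4)) * (∑ i, ∑ j, A i j (w + y t) * w i * w j)
      ≤ E t * (- (c3 * (1 - s))) := by
    have h1 : E t * (- (c3 * (1 - s))) = 4 * (-(2 * E t / r ^ 4)) * (a0 * nsq w) := by
      rw [hρ, hc3]; field_simp; ring
    rw [h1]
    have h2 : 4 * (-(2 * E t / r ^ 4)) ≤ 0 := by
      have : 0 ≤ 2 * E t / r ^ 4 := by positivity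
      linarith
    exact mul_le_mul_of_nonpos_left hell h2
  have k2 : 2 * (2 * E t / r ^ 2 * s) * (∑ i, A i i (w + y t))
      + 2 * (2 * E t / r ^ 2 * s) * (∑ i, b i (w + y t) * w i)
      ≤ E t * (4 / r ^ 2 * (Λ + N * β * r) * s) := by
    have h1 : E t * (4 / r ^ 2 * (Λ + N * β * r) * s)
        = 2 * (2 * E t / r ^ 2 * s) * (Λ + N * β * r) := by field_simp; ring
    rw [h1, ← mul_add]
    apply mul_le_mul_of_nonneg_left _ (by positivity)
    linarith
  have k3 : E t * (-κ * s ^ 2 + 2 * s * (2 * (∑ i, w i * V i) / r ^ 2))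
      ≤ E t * (-κ * s ^ 2 + 2 * (r ^ 2 + R ^ 2) / r ^ 2 * s) := by
    apply mul_le_mul_of_nonneg_left _ hEt.le
    have h1 : 2 * (∑ i, w i * V i) / r ^ 2 ≤ (r ^ 2 + R ^ 2) / r ^ 2 := by gcongr
    have h2 : 2 * s * (2 * (∑ i, w i * V i) / r ^ 2) ≤ 2 * s * ((r ^ 2 + R ^ 2) / r ^ 2) := by
      gcongr
    have h3 : 2 * s * ((r ^ 2 + R ^ 2) / r ^ 2) = 2 * (r ^ 2 + R ^ 2) / r ^ 2 * s := by ring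
    linarith
  have k4 : 0 ≤ E t * (-κ * s ^ 2 + C2 * s - c3) := by
    have k6 : E t * (-κ * s ^ 2 + C2 * s - c3) =
        E t * (-κ * s ^ 2 + 2 * (r ^ 2 + R ^ 2) / r ^ 2 * s)
        + E t * (4 / r ^ 2 * (Λ + N * β * r) * s) + E t * (- (c3 * (1 - s))) := by
      rw [hC2]; ring
    rw [k6]
    linarith
  have k5 : -κ * s ^ 2 + C2 * s - c3 < 0 := by
    have : -κ * s ^ 2 + C2 * s - c3 = -(((C2 * s) ^ 2 - (C2 * s) * c3 + c3 ^ 2) / c3) := by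
      rw [hκ]; field_simp; ring
    rw [this, neg_lt_zero]
    apply div_pos _ hc3p
    nlinarith [sq_nonneg (C2 * s - c3 / 2), sq_nonneg (C2 * s)]
  exact absurd k4 (not_le.2 (mul_neg_of_pos_of_neg hEt k5))

lemma cs_dot {N : ℕ} (z ξ : Fin N → ℝ) : (∑ i, z i * ξ i) ^ 2 ≤ nsq z * nsq ξ :=
  Finset.sum_mul_sq_le_sq_mul_sq _ _ _

lemma quad_zz {N : ℕ} (m : ℝ) (z ξ : Fin N → ℝ) :
    ∑ i, ∑ j, (m * z i * z j) * ξ i * ξ j = m * (∑ i, z i * ξ i) ^ 2 := by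
  rw [sq, Finset.sum_mul_sum, Finset.mul_sum]
  refine Finset.sum_congr rfl (fun i _ => ?_)
  rw [Finset.mul_sum]
  exact Finset.sum_congr rfl (fun j _ => by ring)

lemma quad_id {N : ℕ} (ω : ℝ) (ξ : Fin N → ℝ) :
    ∑ i, ∑ j, (if i = j then ω else 0) * ξ i * ξ j = ω * nsq ξ := by
  rw [nsq, Finset.mul_sum]
  refine Finset.sum_congr rfl (fun i _ => ?_)
  simp [ite_mul]
  ring

lemma quad_small {N : ℕ} (M : Fin N → Fin N → ℝ) {ω : ℝ} (hM : ∀ i j, |M i j| ≤ ω)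
    (ξ : Fin N → ℝ) : |∑ i, ∑ j, M i j * ξ i * ξ j| ≤ N * ω * nsq ξ := by
  have h1 : |∑ i, ∑ j, M i j * ξ i * ξ j| ≤ ∑ i, ∑ j, ω * ((ξ i ^ 2 + ξ j ^ 2) / 2) := by
    refine (Finset.abs_sum_le_sum_abs _ _).trans (Finset.sum_le_sum (fun i _ => ?_))
    refine (Finset.abs_sum_le_sum_abs _ _).trans (Finset.sum_le_sum (fun j _ => ?_))
    rw [mul_assoc, abs_mul]
    refine mul_le_mul (hM i j) ?_ (abs_nonneg _) ((abs_nonneg _).trans (hM i j))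
    rw [abs_le]
    constructor <;> nlinarith [sq_nonneg (ξ i - ξ j), sq_nonneg (ξ i + ξ j)]
  refine h1.trans_eq ?_
  simp only [← Finset.mul_sum, ← Finset.sum_div, Finset.sum_add_distrib]
  simp only [Finset.sum_const, Finset.card_univ, Fintype.card_fin, nsmul_eq_mul, nsq]
  rw [← Finset.mul_sum]
  ring

lemma double_touch {N : ℕ} {A : Fin N → Fin N → (Fin N → ℝ) → ℝ}
    {b : Fin N → (Fin N → ℝ) → ℝ} {a0 Λ β : ℝ} (hcf : CF A b a0 Λ β)
    {g : (Fin N → ℝ) → ℝ} (hg : ContDiff ℝ 2 g) (x y x0 : Fin N → ℝ) (χ χ1 : ℝ → ℝ) (χ2 K1 ω R : ℝ)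
    (hρ : 0 < nsq (x - y))
    (h1 : ∀ᶠ ρ in 𝓝 (nsq (x - y)), HasDerivAt χ (χ1 ρ) ρ)
    (h2 : HasDerivAt χ1 χ2 (nsq (x - y))) (hχ1 : 0 ≤ χ1 (nsq (x - y))) (hχ2 : χ2 ≤ 0)
    (hK1 : 0 ≤ K1) (hR : 0 ≤ R) (hxR : nsq (x - x0) ≤ R ^ 2)
    (hω : ∀ i j, |A i j x - A i j y| ≤ ω) (hω2 : N * ω ≤ a0 / 2)
    (hmax : ∀ᶠ p in 𝓝 (x, y), g p.1 - g p.2 - χ (nsq (p.1 - p.2)) - K1 * nsq (p.1 - x0)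
      ≤ g x - g y - χ (nsq (x - y)) - K1 * nsq (x - x0)) :
    Lop A b g x - Lop A b g y ≤
      a0 / (2 * nsq (x - y)) * (16 * χ2 * nsq (x - y) ^ 2 + 8 * χ1 (nsq (x - y)) * nsq (x - y))
      + 4 * χ1 (nsq (x - y)) * (N * (N * ω)) + 4 * χ1 (nsq (x - y)) * (N * β * √(nsq (x - y)))
      + K1 * (2 * Λ + 2 * (N * β * R)) := by
  obtain ⟨z, hz⟩ : ∃ z, z = x - y := ⟨_, rfl⟩
  rw [← hz] at hρ h1 h2 hχ1 hmax ⊢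
  obtain ⟨c1, hc1⟩ : ∃ c1, c1 = χ1 (nsq z) := ⟨_, rfl⟩
  have key : ∀ ξ η : Fin N → ℝ,
      (∑ i, ξ i * pd i g x) - (∑ i, η i * pd i g y) =
        c1 * (2 * ∑ i, z i * (ξ - η) i) + K1 * (2 * ∑ i, (x - x0) i * ξ i) ∧
      (∑ i, ∑ j, ξ i * ξ j * pd2 i j g x) - (∑ i, ∑ j, η i * η j * pd2 i j g y) ≤
        (χ2 * (2 * ∑ i, z i * (ξ - η) i) ^ 2 + 2 * c1 * nsq (ξ - η)) + 2 * K1 * nsq ξ := by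
    intro ξ η
    have e1 := chi_line1 χ χ1 z (ξ - η) h1
    have e2 := chi_line2 χ1 χ2 z (ξ - η) h2
    have e3 := chi_line1 (fun ρ => K1 * ρ) (fun _ => K1) (x - x0) ξ
      (Eventually.of_forall (fun ρ => by simpa using (hasDerivAt_id ρ).const_mul K1))
    have e4 := chi_line2 (fun _ => K1) 0 (x - x0) ξ (hasDerivAt_const _ _)
    have hc : Tendsto (fun s : ℝ => (x + s • ξ, y + s • η)) (𝓝 0) (𝓝 (x, y)) := by
      have : Continuous (fun s : ℝ => (x + s • ξ, y + s • η)) := by fun_prop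
      simpa using this.tendsto 0
    have hgd := hg.differentiable (by norm_num)
    have e13 := e1.and e3
    have := max1d (G := fun s : ℝ => g (x + s • ξ) - g (y + s • η) - χ (nsq (z + s • (ξ - η)))
        - K1 * nsq (x - x0 + s • ξ))
      (e13.mono (fun s hs => (((line1 hgd x ξ s).fun_sub (line1 hgd y η s)).fun_sub
        hs.1).fun_sub hs.2))
      ((((line2 hg x ξ).fun_sub (line2 hg y η)).fun_sub e2).fun_sub e4)
      (by
        filter_upwards [hc.eventually hmax] with s hs
        have e : x + s • ξ - (y + s • η) = z + s • (ξ - η) := by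
          rw [hz, smul_sub]; abel
        have e' : x + s • ξ - x0 = x - x0 + s • ξ := by abel
        rw [e, e'] at hs
        simpa using hs)
    obtain ⟨t1, t2⟩ := this
    simp only [zero_smul, add_zero, zero_mul, zero_add, ← hc1] at t1 t2
    constructor
    · linarith
    · linarith
  have hgy : ∀ i, pd i g y = 2 * c1 * z i := by
    intro i
    have := (key 0 (Pi.single i 1)).1
    rw [sum_pd_single] at this
    simp [Pi.single_apply] at this
    linarith
  have hgx : ∀ i, pd i g x = 2 * c1 * z i + 2 * K1 * (x - x0) i := by
    intro i
    have := (key (Pi.single i 1) 0).1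
    rw [sum_pd_single] at this
    simp [Pi.single_apply] at this
    simp
    linarith
  -- first order part
  have hfirst : (∑ i, b i x * pd i g x) - (∑ i, b i y * pd i g y) ≤
      4 * c1 * (N * β * √(nsq z)) + K1 * (2 * (N * β * R)) := by
    have q1 : (∑ i, b i x * pd i g x) = 2 * c1 * (∑ i, b i x * z i)
        + 2 * K1 * ∑ i, b i x * (x - x0) i := by
      rw [Finset.mul_sum, Finset.mul_sum, ← Finset.sum_add_distrib]
      exact Finset.sum_congr rfl (fun i _ => by rw [hgx]; ring)
    have q2 : (∑ i, b i y * pd i g y) = 2 * c1 * (∑ i, b i y * z i) := by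
      rw [Finset.mul_sum]
      exact Finset.sum_congr rfl (fun i _ => by rw [hgy]; ring)
    have hsq := (Real.sq_sqrt (nsq_nonneg z)).ge
    have d1 := (abs_le.1 (dot_bound (fun i => b i x) z (fun i => hcf.bb i _) hcf.bnn
      (Real.sqrt_nonneg _) hsq)).2
    have d2 := (abs_le.1 (dot_bound (fun i => b i y) z (fun i => hcf.bb i _) hcf.bnn
      (Real.sqrt_nonneg _) hsq)).1
    have d3 := (abs_le.1 (dot_bound (fun i => b i x) (x - x0) (fun i => hcf.bb i _) hcf.bnn
      hR hxR)).2
    have d4 : c1 * ((∑ i, b i x * z i) - ∑ i, b i y * z i) ≤ c1 * (2 * (N * β * √(nsq z))) := by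
      apply mul_le_mul_of_nonneg_left _ (by rw [hc1]; exact hχ1)
      linarith
    have d5 : K1 * (∑ i, b i x * (x - x0) i) ≤ K1 * (N * β * R) :=
      mul_le_mul_of_nonneg_left d3 hK1
    rw [q1, q2]
    linarith
  -- second order part
  obtain ⟨m, hm⟩ : ∃ m, m = a0 / (2 * nsq z) := ⟨_, rfl⟩
  have hm0 : 0 ≤ m := by rw [hm]; have := hcf.a0_pos; positivity
  obtain ⟨w, hw⟩ : ∃ w : ℝ, w = N * ω := ⟨_, rfl⟩
  let P : Fin N → Fin N → ℝ := fun i j => (A i j x - A i j y) / 2 + (if i = j then w else 0)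
  let Q : Fin N → Fin N → ℝ := fun i j => -(A i j x - A i j y) / 2 + (if i = j then w else 0)
  let D : Fin N → Fin N → ℝ := fun i j => (A i j x + A i j y) / 2 - (if i = j then w else 0)
    - m * z i * z j
  have hbase : ∀ ξ : Fin N → ℝ, |∑ i, ∑ j, (A i j x - A i j y) * ξ i * ξ j| ≤ w * nsq ξ := by
    intro ξ; rw [hw]; exact quad_small _ hω ξ
  have hPq : ∀ ξ : Fin N → ℝ, ∑ i, ∑ j, P i j * ξ i * ξ j =
      (∑ i, ∑ j, (A i j x - A i j y) * ξ i * ξ j) / 2 + w * nsq ξ := by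
    intro ξ
    rw [← quad_id w ξ, Finset.sum_div, ← Finset.sum_add_distrib]
    refine Finset.sum_congr rfl (fun i _ => ?_)
    rw [Finset.sum_div, ← Finset.sum_add_distrib]
    exact Finset.sum_congr rfl (fun j _ => by simp only [P]; ring)
  have hQq : ∀ ξ : Fin N → ℝ, ∑ i, ∑ j, Q i j * ξ i * ξ j =
      -(∑ i, ∑ j, (A i j x - A i j y) * ξ i * ξ j) / 2 + w * nsq ξ := by
    intro ξ
    rw [← quad_id w ξ, ← Finset.sum_neg_distrib, Finset.sum_div, ← Finset.sum_add_distrib]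
    refine Finset.sum_congr rfl (fun i _ => ?_)
    rw [← Finset.sum_neg_distrib, Finset.sum_div, ← Finset.sum_add_distrib]
    exact Finset.sum_congr rfl (fun j _ => by simp only [Q]; ring)
  have hDq : ∀ ξ : Fin N → ℝ, ∑ i, ∑ j, D i j * ξ i * ξ j =
      ((∑ i, ∑ j, A i j x * ξ i * ξ j) + (∑ i, ∑ j, A i j y * ξ i * ξ j)) / 2 - w * nsq ξ
        - m * (∑ i, z i * ξ i) ^ 2 := by
    intro ξ
    rw [← quad_id w ξ, ← quad_zz m z ξ, ← Finset.sum_add_distrib, Finset.sum_div,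
      ← Finset.sum_sub_distrib, ← Finset.sum_sub_distrib]
    refine Finset.sum_congr rfl (fun i _ => ?_)
    rw [← Finset.sum_add_distrib, Finset.sum_div,
      ← Finset.sum_sub_distrib, ← Finset.sum_sub_distrib]
    exact Finset.sum_congr rfl (fun j _ => by simp only [D]; ring)
  have hite : ∀ i j : Fin N, (if i = j then w else 0) = (if j = i then w else 0) := by
    intro i j; simp only [eq_comm]
  obtain ⟨p, hp⟩ := psd_decomp P
    (fun i j => by simp only [P]; rw [hcf.sym i j x, hcf.sym i j y, hite i j])
    (fun ξ => by
      rw [hPq]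
      have := (abs_le.1 (hbase ξ)).1
      have h0 : 0 ≤ w * nsq ξ := (abs_nonneg _).trans (hbase ξ)
      linarith)
  obtain ⟨q, hq⟩ := psd_decomp Q
    (fun i j => by simp only [Q]; rw [hcf.sym i j x, hcf.sym i j y, hite i j])
    (fun ξ => by
      rw [hQq]
      have := (abs_le.1 (hbase ξ)).2
      have h0 : 0 ≤ w * nsq ξ := (abs_nonneg _).trans (hbase ξ)
      linarith)
  obtain ⟨d, hd⟩ := psd_decomp D
    (fun i j => by simp only [D]; rw [hcf.sym i j x, hcf.sym i j y, hite i j]; ring)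
    (fun ξ => by
      rw [hDq]
      have e1 := hcf.ell x ξ
      have e2 := hcf.ell y ξ
      have e3 : w * nsq ξ ≤ a0 / 2 * nsq ξ := by
        apply mul_le_mul_of_nonneg_right _ (nsq_nonneg ξ)
        rw [hw]; exact hω2
      have e4 : m * (∑ i, z i * ξ i) ^ 2 ≤ a0 / 2 * nsq ξ := by
        have : m * (∑ i, z i * ξ i) ^ 2 ≤ m * (nsq z * nsq ξ) :=
          mul_le_mul_of_nonneg_left (cs_dot z ξ) hm0
        refine this.trans_eq ?_
        have hne := hρ.ne'
        rw [hm]; field_simp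
      linarith)
  have hAx : ∑ i, ∑ j, A i j x * pd2 i j g x =
      m * (∑ i, ∑ j, z i * z j * pd2 i j g x) + (∑ k, ∑ i, ∑ j, d k i * d k j * pd2 i j g x)
      + ∑ k, ∑ i, ∑ j, p k i * p k j * pd2 i j g x := by
    rw [← sum_decomp D d hd, ← sum_decomp P p hp, Finset.mul_sum, ← Finset.sum_add_distrib,
      ← Finset.sum_add_distrib]
    refine Finset.sum_congr rfl (fun i _ => ?_)
    rw [Finset.mul_sum, ← Finset.sum_add_distrib, ← Finset.sum_add_distrib]
    exact Finset.sum_congr rfl (fun j _ => by simp only [D, P]; ring)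
  have hAy : ∑ i, ∑ j, A i j y * pd2 i j g y =
      m * (∑ i, ∑ j, z i * z j * pd2 i j g y) + (∑ k, ∑ i, ∑ j, d k i * d k j * pd2 i j g y)
      + ∑ k, ∑ i, ∑ j, q k i * q k j * pd2 i j g y := by
    rw [← sum_decomp D d hd, ← sum_decomp Q q hq, Finset.mul_sum, ← Finset.sum_add_distrib,
      ← Finset.sum_add_distrib]
    refine Finset.sum_congr rfl (fun i _ => ?_)
    rw [Finset.mul_sum, ← Finset.sum_add_distrib, ← Finset.sum_add_distrib]
    exact Finset.sum_congr rfl (fun j _ => by simp only [D, Q]; ring)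
  have hc10 : 0 ≤ c1 := by rw [hc1]; exact hχ1
  -- direction (z, -z)
  have f1 : (∑ i, ∑ j, z i * z j * pd2 i j g x) - (∑ i, ∑ j, z i * z j * pd2 i j g y) ≤
      16 * χ2 * nsq z ^ 2 + 8 * c1 * nsq z + 2 * K1 * nsq z := by
    have := (key z (-z)).2
    have e1 : ∑ i, z i * (z - -z) i = 2 * nsq z := by
      rw [nsq, Finset.mul_sum]
      exact Finset.sum_congr rfl (fun i _ => by simp; ring)
    have e2 : nsq (z - -z) = 4 * nsq z := by
      rw [nsq, nsq, Finset.mul_sum]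
      exact Finset.sum_congr rfl (fun i _ => by simp; ring)
    rw [e1, e2] at this
    simp only [Pi.neg_apply, neg_mul_neg] at this
    linarith
  have f2 : (∑ k, ∑ i, ∑ j, d k i * d k j * pd2 i j g x)
      - (∑ k, ∑ i, ∑ j, d k i * d k j * pd2 i j g y) ≤ 2 * K1 * ∑ i, D i i := by
    rw [← sum_decomp_nsq D d hd, ← Finset.sum_sub_distrib, Finset.mul_sum]
    refine Finset.sum_le_sum (fun k _ => ?_)
    have := (key (d k) (d k)).2
    simpa [nsq] using this
  have f3 : (∑ k, ∑ i, ∑ j, p k i * p k j * pd2 i j g x) ≤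
      (2 * c1 + 2 * K1) * ∑ i, P i i := by
    rw [← sum_decomp_nsq P p hp, Finset.mul_sum]
    refine Finset.sum_le_sum (fun k _ => ?_)
    have := (key (p k) 0).2
    simp only [sub_zero, Pi.zero_apply, zero_mul, Finset.sum_const_zero] at this
    have h3 : χ2 * (2 * ∑ i, z i * p k i) ^ 2 ≤ 0 :=
      mul_nonpos_of_nonpos_of_nonneg hχ2 (sq_nonneg _)
    linarith
  have f4 : - (∑ k, ∑ i, ∑ j, q k i * q k j * pd2 i j g y) ≤ 2 * c1 * ∑ i, Q i i := by
    rw [← sum_decomp_nsq Q q hq, Finset.mul_sum, ← Finset.sum_neg_distrib]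
    refine Finset.sum_le_sum (fun k _ => ?_)
    have := (key 0 (q k)).2
    have e2 : nsq (0 - q k) = nsq (q k) := by simp [nsq]
    have e3 : nsq (0 : Fin N → ℝ) = 0 := by simp [nsq]
    rw [e2, e3] at this
    simp only [Pi.zero_apply, zero_mul, Finset.sum_const_zero] at this
    have h3 : χ2 * (2 * ∑ i, z i * (0 - q k) i) ^ 2 ≤ 0 :=
      mul_nonpos_of_nonpos_of_nonneg hχ2 (sq_nonneg _)
    linarith
  have t1 : (∑ i, P i i) + ∑ i, Q i i = 2 * (N * w) := by
    rw [← Finset.sum_add_distrib]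
    have : ∀ i : Fin N, P i i + Q i i = 2 * w := by intro i; simp [P, Q]; ring
    simp [this]; ring
  have t2 : m * nsq z + (∑ i, D i i) + (∑ i, P i i) = ∑ i, A i i x := by
    rw [nsq, Finset.mul_sum, ← Finset.sum_add_distrib, ← Finset.sum_add_distrib]
    exact Finset.sum_congr rfl (fun i _ => by simp [D, P]; ring)
  have t3 := mul_le_mul_of_nonneg_left (hcf.tr x) hK1
  have f1' := mul_le_mul_of_nonneg_left f1 hm0
  have t1' : c1 * (∑ i, P i i) + c1 * ∑ i, Q i i = c1 * (2 * (N * w)) := by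
    rw [← mul_add, t1]
  have t2' : K1 * (m * nsq z) + K1 * (∑ i, D i i) + K1 * (∑ i, P i i) = K1 * ∑ i, A i i x := by
    rw [← mul_add, ← mul_add, t2]
  unfold Lop
  rw [hAx, hAy, ← hc1, ← hm, ← hw]
  linarith

set_option maxHeartbeats 1000000 in
lemma holder {N : ℕ} {A : Fin N → Fin N → (Fin N → ℝ) → ℝ}
    {b : Fin N → (Fin N → ℝ) → ℝ} {a0 Λ β : ℝ} (hcf : CF A b a0 Λ β) {K : ℝ} (hK0 : 0 ≤ K) :
    ∃ H r0 : ℝ, 0 < H ∧ 0 < r0 ∧ ∀ v : (Fin N → ℝ) → ℝ → ℝ, RegSol v → (∀ x t, |v x t| ≤ K) →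
      (∀ x t, deriv (fun s => v x s) t = Lop A b (fun y => v y t) x) →
      ∀ (x0 y0 : Fin N → ℝ) (t0 : ℝ), nsq (x0 - y0) ≤ r0 ^ 2 →
        v x0 t0 - v y0 t0 ≤ H * nsq (x0 - y0) ^ (1 / 4 : ℝ) := by
  have ha0 := hcf.a0_pos
  have hβ := hcf.bnn
  have hΛ := hcf.Lnn
  obtain ⟨ω, hωd⟩ : ∃ ω : ℝ, ω = a0 / (8 * (N + 1) ^ 2) := ⟨_, rfl⟩
  have hω0 : 0 < ω := by rw [hωd]; positivity
  have hN0 : (0:ℝ) ≤ N := by positivity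
  have hωN : ω * (N + 1) ^ 2 = a0 / 8 := by rw [hωd]; field_simp
  have hω1 : N * ω ≤ a0 / 2 := by nlinarith [mul_nonneg hω0.le hN0, mul_nonneg hω0.le (sq_nonneg (N:ℝ))]
  have hω2 : N * (N * ω) ≤ a0 / 8 := by nlinarith [mul_nonneg hω0.le hN0]
  obtain ⟨r1, hr1, huc⟩ := hcf.uc ω hω0
  obtain ⟨r0, hr0d⟩ : ∃ r0 : ℝ, r0 = min r1 (min 1 (a0 / (8 * (N * β + 1)))) := ⟨_, rfl⟩
  have hr0 : 0 < r0 := by rw [hr0d]; positivity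
  have hr01 : r0 ≤ r1 := by rw [hr0d]; exact min_le_left _ _
  have hr02 : r0 ≤ 1 := by rw [hr0d]; exact (min_le_right _ _).trans (min_le_left _ _)
  have hr03 : N * β * r0 ≤ a0 / 8 := by
    have h1 : r0 ≤ a0 / (8 * (N * β + 1)) := by
      rw [hr0d]; exact (min_le_right _ _).trans (min_le_right _ _)
    rw [le_div_iff₀ (by positivity)] at h1
    nlinarith
  obtain ⟨K1, hK1⟩ : ∃ K1 : ℝ, K1 = 2 * K + 1 := ⟨_, rfl⟩
  have hK1p : 0 < K1 := by rw [hK1]; positivity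
  obtain ⟨Cc, hCc⟩ : ∃ Cc : ℝ, Cc = 2 * Λ + 2 * (N * β * 1) := ⟨_, rfl⟩
  have hCc0 : 0 ≤ Cc := by rw [hCc]; positivity
  obtain ⟨H, hH⟩ : ∃ H : ℝ, H = 8 * K1 * (Cc + 1) / a0 + K1 / √r0 := ⟨_, rfl⟩
  have hHp : 0 < H := by rw [hH]; positivity
  have hH1 : K1 * (Cc + 1) < H * (a0 / 4) := by
    have h1 : 8 * K1 * (Cc + 1) / a0 ≤ H := by
      rw [hH]; have : 0 ≤ K1 / √r0 := by positivity
      linarith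
    rw [div_le_iff₀ ha0] at h1
    have : 0 < K1 * (Cc + 1) := by positivity
    linarith
  have hH2 : K1 ≤ H * √r0 := by
    have h1 : K1 / √r0 ≤ H := by
      rw [hH]; have : 0 ≤ 8 * K1 * (Cc + 1) / a0 := by positivity
      linarith
    rwa [div_le_iff₀ (Real.sqrt_pos.2 hr0)] at h1
  refine ⟨H, r0, hHp, hr0, ?_⟩
  intro v hv hK heq x0 y0 t0 hxy
  by_contra hcon
  push Not at hcon
  let S : Set ((Fin N → ℝ) × (Fin N → ℝ) × ℝ) :=
    {w | nsq w ≤ 1} ×ˢ {w | nsq w ≤ r0 ^ 2} ×ˢ Set.Icc (t0 - 1) t0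
  have hS : IsCompact S := (nsq_compact _).prod ((nsq_compact _).prod isCompact_Icc)
  let F : (Fin N → ℝ) × (Fin N → ℝ) × ℝ → ℝ :=
    fun p => v (p.1 + x0) p.2.2 - v (p.1 + x0 - p.2.1) p.2.2 - H * nsq p.2.1 ^ (1 / 4 : ℝ)
      - K1 * nsq p.1 - K1 * (t0 - p.2.2)
  have hFc : Continuous F := by
    have h1 : Continuous fun p : (Fin N → ℝ) × (Fin N → ℝ) × ℝ => v (p.1 + x0) p.2.2 :=
      hv.1.comp (f := fun p : (Fin N → ℝ) × (Fin N → ℝ) × ℝ => (p.1 + x0, p.2.2)) (by fun_prop)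
    have h2 : Continuous fun p : (Fin N → ℝ) × (Fin N → ℝ) × ℝ => v (p.1 + x0 - p.2.1) p.2.2 :=
      hv.1.comp (f := fun p : (Fin N → ℝ) × (Fin N → ℝ) × ℝ => (p.1 + x0 - p.2.1, p.2.2))
        (by fun_prop)
    have h3 : Continuous fun p : (Fin N → ℝ) × (Fin N → ℝ) × ℝ => nsq p.2.1 ^ (1 / 4 : ℝ) :=
      (nsq_cont.comp (continuous_fst.comp continuous_snd)).rpow_const
        (fun _ => Or.inr (by norm_num))
    have h4 : Continuous fun p : (Fin N → ℝ) × (Fin N → ℝ) × ℝ => nsq p.1 :=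
      nsq_cont.comp continuous_fst
    exact (((h1.sub h2).sub (h3.const_mul H)).sub (h4.const_mul K1)).sub (by fun_prop)
  have h0S : ((0 : Fin N → ℝ), x0 - y0, t0) ∈ S := by
    refine ⟨?_, hxy, ?_⟩
    · simp [nsq]
    · simp
  obtain ⟨⟨w, z, t⟩, hwS, hmax⟩ := hS.exists_isMaxOn ⟨_, h0S⟩ hFc.continuousOn
  have hF0 : 0 < F (w, z, t) := by
    have h1 : F (0, x0 - y0, t0) ≤ F (w, z, t) := hmax h0S
    have h2 : 0 < F (0, x0 - y0, t0) := by
      have e : nsq (0 : Fin N → ℝ) = 0 := by simp [nsq]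
      simp only [F, e, zero_add, sub_sub_cancel, sub_self, mul_zero, sub_zero]
      linarith
    linarith
  obtain ⟨x, hx⟩ : ∃ x, x = w + x0 := ⟨_, rfl⟩
  obtain ⟨y, hy⟩ : ∃ y, y = w + x0 - z := ⟨_, rfl⟩
  have hxyz : x - y = z := by rw [hx, hy]; abel
  have hxw : x - x0 = w := by rw [hx]; abel
  have hF0' : 0 < v x t - v y t - H * nsq z ^ (1 / 4 : ℝ) - K1 * nsq w - K1 * (t0 - t) := by
    rw [hx, hy]; exact hF0
  have hw1 : nsq w ≤ 1 := hwS.1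
  have hzr : nsq z ≤ r0 ^ 2 := hwS.2.1
  have ht1 : t0 - 1 ≤ t := hwS.2.2.1
  have ht0 : t ≤ t0 := hwS.2.2.2
  have hvx := (abs_le.1 (hK x t)).2
  have hvy := (abs_le.1 (hK y t)).1
  have n1 : 0 ≤ H * nsq z ^ (1 / 4 : ℝ) := mul_nonneg hHp.le (Real.rpow_nonneg (nsq_nonneg z) _)
  have n2 : 0 ≤ K1 * nsq w := mul_nonneg hK1p.le (nsq_nonneg w)
  have n3 : 0 ≤ K1 * (t0 - t) := mul_nonneg hK1p.le (by linarith)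
  have hw1' : nsq w < 1 := by nlinarith
  have ht1' : t0 - 1 < t := by nlinarith
  have hzr' : nsq z < r0 ^ 2 := by
    rcases hzr.lt_or_eq with h | h
    · exact h
    · exfalso
      have : nsq z ^ (1 / 4 : ℝ) = √r0 := by
        rw [h, Real.sqrt_eq_rpow, ← Real.rpow_natCast r0 2, ← Real.rpow_mul hr0.le]
        norm_num
      rw [this] at hF0'
      linarith
  have hz0 : 0 < nsq z := by
    rcases (nsq_nonneg z).lt_or_eq with h | h
    · exact h
    · exfalso
      have hz : z = 0 := by
        ext i
        have := sq_le_nsq z i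
        rw [← h] at this
        exact pow_eq_zero_iff (two_ne_zero) |>.1 (le_antisymm this (sq_nonneg _))
      have : x = y := by rw [← sub_eq_zero, hxyz, hz]
      rw [this] at hF0'
      linarith
  -- time
  have htime : 0 ≤ deriv (fun s => v x s) t - deriv (fun s => v y s) t + K1 := by
    have hd : HasDerivAt (fun s => v x s - v y s - H * nsq z ^ (1 / 4 : ℝ) - K1 * nsq w
        - K1 * (t0 - s)) (deriv (fun s => v x s) t - deriv (fun s => v y s) t + K1) t := by
      have h1 := (hv.2.1 x t).hasDerivAt
      have h1' := (hv.2.1 y t).hasDerivAt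
      have h2 := (((hasDerivAt_id t).const_sub t0).const_mul K1)
      refine ((((h1.fun_sub h1').sub_const (H * nsq z ^ (1 / 4 : ℝ))).sub_const
        (K1 * nsq w)).fun_sub h2).congr_deriv ?_
      ring
    refine left_deriv_nonneg hd ?_
    have : ∀ᶠ s in 𝓝[<] t, t0 - 1 < s := nhdsWithin_le_nhds (eventually_gt_nhds ht1')
    filter_upwards [this, self_mem_nhdsWithin] with s hs hst
    have hst' : s < t := hst
    have hm : (w, z, s) ∈ S := ⟨hw1, hzr, ⟨hs.le, by linarith⟩⟩
    rw [hx, hy]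
    exact hmax hm
  -- space
  have hzx : nsq (x - y) = nsq z := by rw [hxyz]
  have hsp := double_touch hcf (hv.2.2 t) x y x0 (fun ρ => H * ρ ^ (1 / 4 : ℝ))
    (fun ρ => H * ((1 / 4) * ρ ^ (-(3 / 4) : ℝ)))
    (H * ((1 / 4) * (-(3 / 4) * nsq z ^ (-(7 / 4) : ℝ)))) K1 ω 1
    (by rw [hzx]; exact hz0)
    (by
      rw [hzx]
      filter_upwards [eventually_gt_nhds hz0] with ρ hρ
      have := (Real.hasDerivAt_rpow_const (x := ρ) (p := 1 / 4) (Or.inl hρ.ne')).const_mul H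
      norm_num at this ⊢
      exact this)
    (by
      rw [hzx]
      have := ((Real.hasDerivAt_rpow_const (x := nsq z) (p := -(3 / 4))
        (Or.inl hz0.ne')).const_mul (1 / 4)).const_mul H
      norm_num at this ⊢
      exact this)
    (by have := Real.rpow_nonneg (nsq_nonneg (x - y)) (-(3 / 4)); positivity)
    (by
      have h1 := Real.rpow_nonneg (nsq_nonneg z) (-(7 / 4))
      have : 0 ≤ H * (1 / 4 * (3 / 4 * nsq z ^ (-(7 / 4) : ℝ))) := by positivity
      linarith)
    hK1p.le zero_le_one (by rw [hxw]; simpa using hw1)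
    (huc x y (by rw [hzx]; exact hzr.trans (by gcongr))) hω1
    (by
      have hc1 : Tendsto (fun p : (Fin N → ℝ) × (Fin N → ℝ) => nsq (p.1 - x0)) (𝓝 (x, y))
          (𝓝 (nsq w)) := by
        have : Continuous (fun p : (Fin N → ℝ) × (Fin N → ℝ) => nsq (p.1 - x0)) :=
          nsq_cont.comp (by fun_prop)
        simpa [hxw] using this.tendsto (x, y)
      have hc2 : Tendsto (fun p : (Fin N → ℝ) × (Fin N → ℝ) => nsq (p.1 - p.2)) (𝓝 (x, y))
          (𝓝 (nsq z)) := by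
        have : Continuous (fun p : (Fin N → ℝ) × (Fin N → ℝ) => nsq (p.1 - p.2)) :=
          nsq_cont.comp (by fun_prop)
        simpa [hxyz] using this.tendsto (x, y)
      filter_upwards [hc1.eventually (eventually_lt_nhds hw1'),
        hc2.eventually (eventually_lt_nhds hzr')] with p hp1 hp2
      have hm : (p.1 - x0, p.1 - p.2, t) ∈ S := ⟨hp1.le, hp2.le, hwS.2.2⟩
      have h5 : F (p.1 - x0, p.1 - p.2, t) ≤ F (w, z, t) := hmax hm
      simp only [F, sub_add_cancel, sub_sub_cancel] at h5
      rw [← hy, ← hx] at h5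
      rw [hxyz, hxw]
      linarith)
  simp only [hzx] at hsp
  rw [← heq, ← heq, ← hCc] at hsp
  obtain ⟨X, hX⟩ : ∃ X, X = nsq z ^ (-(3 / 4) : ℝ) := ⟨_, rfl⟩
  have hX7 : nsq z ^ (-(7 / 4) : ℝ) * nsq z = X := by
    rw [hX]
    nth_rewrite 2 [← Real.rpow_one (nsq z)]
    rw [← Real.rpow_add hz0]; norm_num
  have hX1 : 1 ≤ X := by
    rw [hX]
    apply Real.one_le_rpow_of_pos_of_le_one_of_nonpos hz0 _ (by norm_num)
    exact hzr.trans (pow_le_one₀ hr0.le hr02)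
  have hsq : √(nsq z) ≤ r0 := Real.sqrt_le_iff.2 ⟨hr0.le, hzr⟩
  rw [← hX] at hsp
  have m1 : a0 / (2 * nsq z) * (16 * (H * (1 / 4 * (-(3 / 4) * nsq z ^ (-(7 / 4) : ℝ)))) * nsq z ^ 2
      + 8 * (H * (1 / 4 * X)) * nsq z) = -(a0 / 2) * (H * X) := by
    have : 16 * (H * (1 / 4 * (-(3 / 4) * nsq z ^ (-(7 / 4) : ℝ)))) * nsq z ^ 2
      + 8 * (H * (1 / 4 * X)) * nsq z = - (H * X * nsq z) := by
      linear_combination (-3 * H * nsq z) * hX7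
    rw [this]
    have hne := hz0.ne'
    field_simp
  have hHX : 0 ≤ H * X := by positivity
  have m2 : 4 * (H * (1 / 4 * X)) * (N * (N * ω)) ≤ H * X * (a0 / 8) := by
    have := mul_le_mul_of_nonneg_left hω2 hHX
    linarith
  have m3 : 4 * (H * (1 / 4 * X)) * (N * β * √(nsq z)) ≤ H * X * (a0 / 8) := by
    have h1 : N * β * √(nsq z) ≤ a0 / 8 := by
      refine le_trans ?_ hr03
      gcongr
    have := mul_le_mul_of_nonneg_left h1 hHX
    linarith
  rw [m1] at hsp
  have m4 : H * (a0 / 4) ≤ H * X * (a0 / 4) := by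
    have h1 : H * 1 ≤ H * X := by gcongr
    rw [mul_one] at h1
    exact mul_le_mul_of_nonneg_right h1 (by positivity)
  linarith

lemma weak_harnack {N : ℕ} {A : Fin N → Fin N → (Fin N → ℝ) → ℝ}
    {b : Fin N → (Fin N → ℝ) → ℝ} {a0 Λ β : ℝ} (hcf : CF A b a0 Λ β) {K δ R T : ℝ}
    (hK0 : 0 ≤ K) (hδ : 0 < δ) :
    ∃ ε : ℝ, 0 < ε ∧ ∀ z : (Fin N → ℝ) → ℝ → ℝ, RegSol z → (∀ x t, 0 ≤ z x t) →
      (∀ x t, z x t ≤ K) →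
      (∀ x t, deriv (fun s => z x s) t = Lop A b (fun y => z y t) x) →
      ∀ (x0 : Fin N → ℝ) (t0 : ℝ), z x0 t0 < ε → ∀ (x1 : Fin N → ℝ) (t1 : ℝ),
        nsq (x0 - x1) ≤ R ^ 2 → t0 - T ≤ t1 → t1 ≤ t0 - 1 → z x1 t1 < δ := by
  obtain ⟨H, r0, hH, hr0, hol⟩ := holder hcf hK0
  obtain ⟨r, hr, hrr, hHr⟩ : ∃ r : ℝ, 0 < r ∧ r ≤ r0 ∧ H * √r ≤ δ / 2 := by
    refine ⟨min r0 ((δ / (2 * H)) ^ 2), by positivity, min_le_left _ _, ?_⟩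
    have h1 : √(min r0 ((δ / (2 * H)) ^ 2)) ≤ δ / (2 * H) :=
      Real.sqrt_le_iff.2 ⟨by positivity, min_le_right _ _⟩
    calc H * √(min r0 ((δ / (2 * H)) ^ 2)) ≤ H * (δ / (2 * H)) := by gcongr
      _ = δ / 2 := by field_simp
  obtain ⟨κ, hκ, hprop⟩ := propagate hcf (R := R) hr
  refine ⟨δ / 2 * Real.exp (-(κ * T)), by positivity, ?_⟩
  intro z hz hz0 hzK heq x0 t0 hlt x1 t1 hR hT1 hT2
  by_contra hcon
  push Not at hcon
  have h1 := hprop z hz hz0 (fun x t => (heq x t).ge) x0 x1 t0 t1 (δ / 2) (by positivity)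
    (by linarith) hR (by
      intro x hx
      have h2 := hol z hz (fun x t => by rw [abs_of_nonneg (hz0 x t)]; exact hzK x t) heq
        x1 x t1 (by
          have e : nsq (x1 - x) = nsq (x - x1) := by
            simp only [nsq, Pi.sub_apply]
            exact Finset.sum_congr rfl (fun i _ => by ring)
          rw [e]
          exact hx.trans (by gcongr))
      have e : nsq (x1 - x) = nsq (x - x1) := by
        simp only [nsq, Pi.sub_apply]
        exact Finset.sum_congr rfl (fun i _ => by ring)
      have h3 : nsq (x1 - x) ^ (1 / 4 : ℝ) ≤ √r := by
        have h4 : (r ^ 2) ^ (1 / 4 : ℝ) = √r := by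
          rw [Real.sqrt_eq_rpow, ← Real.rpow_natCast r 2, ← Real.rpow_mul hr.le]
          norm_num
        rw [e, ← h4]
        exact Real.rpow_le_rpow (nsq_nonneg _) hx (by norm_num)
      have h5 : H * nsq (x1 - x) ^ (1 / 4 : ℝ) ≤ H * √r := by gcongr
      linarith)
  have h6 : δ / 2 * Real.exp (-(κ * T)) ≤ δ / 2 * Real.exp (-(κ * (t0 - t1))) := by
    gcongr
    linarith
  linarith

lemma pd_add_right {N : ℕ} (i : Fin N) (g : (Fin N → ℝ) → ℝ) (ξ x : Fin N → ℝ) :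
    pd i (fun y => g (y + ξ)) x = pd i g (x + ξ) := by
  unfold pd
  rw [fderiv_comp_add_right]

lemma pd2_add_right {N : ℕ} (i j : Fin N) (g : (Fin N → ℝ) → ℝ) (ξ x : Fin N → ℝ) :
    pd2 i j (fun y => g (y + ξ)) x = pd2 i j g (x + ξ) := by
  unfold pd2
  simp only [pd_add_right]

lemma pd_sub' {N : ℕ} (i : Fin N) {g h : (Fin N → ℝ) → ℝ} (x : Fin N → ℝ)
    (hg : DifferentiableAt ℝ g x) (hh : DifferentiableAt ℝ h x) :
    pd i (fun y => g y - h y) x = pd i g x - pd i h x := by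
  unfold pd
  rw [fderiv_fun_sub hg hh]; rfl

lemma pd2_sub' {N : ℕ} (i j : Fin N) {g h : (Fin N → ℝ) → ℝ} (x : Fin N → ℝ)
    (hg : ContDiff ℝ 2 g) (hh : ContDiff ℝ 2 h) :
    pd2 i j (fun y => g y - h y) x = pd2 i j g x - pd2 i j h x := by
  unfold pd2
  have : (fun y => pd j (fun y => g y - h y) y) = fun y => pd j g y - pd j h y := by
    funext y
    exact pd_sub' j y (hg.differentiable (by norm_num) y) (hh.differentiable (by norm_num) y)
  rw [this]
  exact pd_sub' i x ((pd_contDiff1 hg j).differentiable (by norm_num) x)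
    ((pd_contDiff1 hh j).differentiable (by norm_num) x)

lemma Lop_sub' {N : ℕ} {A : Fin N → Fin N → (Fin N → ℝ) → ℝ}
    {b : Fin N → (Fin N → ℝ) → ℝ} {g h : (Fin N → ℝ) → ℝ} (x : Fin N → ℝ)
    (hg : ContDiff ℝ 2 g) (hh : ContDiff ℝ 2 h) :
    Lop A b (fun y => g y - h y) x = Lop A b g x - Lop A b h x := by
  unfold Lop
  simp only [pd2_sub' _ _ x hg hh, pd_sub' _ x (hg.differentiable (by norm_num) x)
    (hh.differentiable (by norm_num) x), mul_sub, Finset.sum_sub_distrib]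
  ring

lemma Lop_const {N : ℕ} {A : Fin N → Fin N → (Fin N → ℝ) → ℝ}
    {b : Fin N → (Fin N → ℝ) → ℝ} (M : ℝ) (x : Fin N → ℝ) :
    Lop A b (fun _ => M) x = 0 := by
  unfold Lop pd2 pd
  simp

lemma RegSol_sub {N : ℕ} {v w : (Fin N → ℝ) → ℝ → ℝ} (hv : RegSol v) (hw : RegSol w) :
    RegSol (fun x t => v x t - w x t) :=
  ⟨hv.1.sub hw.1, fun x => (hv.2.1 x).sub (hw.2.1 x), fun t => (hv.2.2 t).sub (hw.2.2 t)⟩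

lemma RegSol_const {N : ℕ} (M : ℝ) : RegSol (fun (_ : Fin N → ℝ) (_ : ℝ) => M) :=
  ⟨continuous_const, fun _ => differentiable_const _, fun _ => contDiff_const⟩

lemma RegSol_shift {N : ℕ} {v : (Fin N → ℝ) → ℝ → ℝ} (hv : RegSol v) (ξ : Fin N → ℝ) (σ : ℝ) :
    RegSol (fun x t => v (x + ξ) (t + σ)) := by
  refine ⟨?_, fun x => ?_, fun t => ?_⟩
  · exact hv.1.comp (f := fun p : (Fin N → ℝ) × ℝ => (p.1 + ξ, p.2 + σ)) (by fun_prop)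
  · exact (hv.2.1 (x + ξ)).comp (f := fun s => s + σ) (by fun_prop)
  · exact (hv.2.2 (t + σ)).comp (f := fun y : Fin N → ℝ => y + ξ) (by fun_prop)

/-- The difference of a solution and its translate solves the homogeneous equation. -/
lemma shift_eq {N : ℕ} {A : Fin N → Fin N → (Fin N → ℝ) → ℝ}
    {b : Fin N → (Fin N → ℝ) → ℝ} {v g : (Fin N → ℝ) → ℝ → ℝ} {lam : ℝ}
    (hv : RegSol v)
    (heq : ∀ x t, deriv (fun s => v x s) t = Lop A b (fun y => v y t) x - lam * v x t + g x t)
    (ξ : Fin N → ℝ) (σ : ℝ) (hA : ∀ i j x, A i j (x + ξ) = A i j x)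
    (hb : ∀ i x, b i (x + ξ) = b i x) (hg : ∀ x t, g (x + ξ) (t + σ) = g x t) (x : Fin N → ℝ)
    (t : ℝ) :
    deriv (fun s => v (x + ξ) (s + σ) - v x s) t
      = Lop A b (fun y => v (y + ξ) (t + σ) - v y t) x - lam * (v (x + ξ) (t + σ) - v x t) := by
  have hs := RegSol_shift hv ξ σ
  rw [deriv_fun_sub (hs.2.1 x t) (hv.2.1 x t), Lop_sub' x (hs.2.2 t) (hv.2.2 t)]
  have h1 : deriv (fun s => v (x + ξ) (s + σ)) t = deriv (fun s => v (x + ξ) s) (t + σ) :=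
    deriv_comp_add_const (fun s => v (x + ξ) s) σ t
  have h2 : Lop A b (fun y => v (y + ξ) (t + σ)) x = Lop A b (fun y => v y (t + σ)) (x + ξ) := by
    unfold Lop
    simp only [pd2_add_right _ _ (fun y => v y (t + σ)), pd_add_right _ (fun y => v y (t + σ)),
      hA, hb]
  rw [h1, h2, heq, heq, hg]
  ring

/-- Zero-order-free case: the translate is below the original. -/
lemma shift_le {N : ℕ} {A : Fin N → Fin N → (Fin N → ℝ) → ℝ}
    {b : Fin N → (Fin N → ℝ) → ℝ} {a0 Λ β : ℝ} (hcf : CF A b a0 Λ β)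
    {v g : (Fin N → ℝ) → ℝ → ℝ} {K : ℝ}
    (hv : RegSol v) (hK : ∀ x t, |v x t| ≤ K)
    (heq : ∀ x t, deriv (fun s => v x s) t = Lop A b (fun y => v y t) x - 0 * v x t + g x t)
    (ξ : Fin N → ℝ) (σ : ℝ) (hA : ∀ i j x, A i j (x + ξ) = A i j x)
    (hb : ∀ i x, b i (x + ξ) = b i x) (hg : ∀ x t, g (x + ξ) (t + σ) = g x t) :
    ∀ x t, v (x + ξ) (t + σ) - v x t ≤ 0 := by
  have hweq := shift_eq hv heq ξ σ hA hb hg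
  have hwreg : RegSol (fun x t => v (x + ξ) (t + σ) - v x t) := RegSol_sub (RegSol_shift hv ξ σ) hv
  have hK0 : 0 ≤ K := (abs_nonneg _).trans (hK 0 0)
  by_contra hcon
  push Not at hcon
  obtain ⟨xa, ta, hpos⟩ := hcon
  let Sset : Set ℝ := Set.range fun p : (Fin N → ℝ) × ℝ => v (p.1 + ξ) (p.2 + σ) - v p.1 p.2
  have hw2 : ∀ x t, |v (x + ξ) (t + σ) - v x t| ≤ 2 * K := fun x t => by
    have := abs_sub (v (x + ξ) (t + σ)) (v x t)
    have h1 := hK (x + ξ) (t + σ)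
    have h2 := hK x t
    linarith
  have hbd : BddAbove Sset := ⟨2 * K, by
    rintro _ ⟨p, rfl⟩
    exact (abs_le.1 (hw2 p.1 p.2)).2⟩
  obtain ⟨M, hM⟩ : ∃ M, M = sSup Sset := ⟨_, rfl⟩
  have hle : ∀ x t, v (x + ξ) (t + σ) - v x t ≤ M := fun x t => by
    rw [hM]; exact le_csSup hbd ⟨(x, t), rfl⟩
  have hMpos : 0 < M := hpos.trans_le (hle xa ta)
  obtain ⟨k, hk⟩ := exists_nat_gt (2 * K / (M / 2))
  rw [div_lt_iff₀ (by positivity)] at hk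
  obtain ⟨R, hR⟩ : ∃ R : ℝ, R = k * √(nsq ξ) := ⟨_, rfl⟩
  obtain ⟨ε, hε, hwh⟩ := weak_harnack hcf (K := M + 2 * K) (δ := M / 2) (R := R)
    (T := 1 + 2 * (k * |σ|)) (by positivity) (by positivity)
  obtain ⟨_, ⟨⟨x0, t0⟩, rfl⟩, hnear⟩ : ∃ y ∈ Sset, M - ε < y := by
    apply exists_lt_of_lt_csSup (Set.range_nonempty _)
    rw [← hM]; linarith
  simp only at hnear
  have hz := hwh (fun x t => M - (v (x + ξ) (t + σ) - v x t)) (RegSol_sub (RegSol_const M) hwreg)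
    (fun x t => by linarith [hle x t]) (fun x t => by linarith [(abs_le.1 (hw2 x t)).1])
    (fun x t => by
      rw [deriv_const_sub, hweq, Lop_sub' x contDiff_const (hwreg.2.2 t), Lop_const]
      ring) x0 t0 (by linarith)
  obtain ⟨tb, htb⟩ : ∃ tb, tb = t0 - 1 - k * |σ| := ⟨_, rfl⟩
  have hchain : ∀ j : ℕ, j < k → M / 2 < v (x0 + (j : ℝ) • ξ + ξ) (tb + j * σ + σ)
      - v (x0 + (j : ℝ) • ξ) (tb + j * σ) := by
    intro j hj
    have hjk : (j : ℝ) ≤ k := by exact_mod_cast hj.le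
    have h1 : |j * σ| ≤ k * |σ| := by
      rw [abs_mul, Nat.abs_cast]; gcongr
    have h1' := abs_le.1 h1
    have := hz (x0 + (j : ℝ) • ξ) (tb + j * σ) (by
      have e : nsq (x0 - (x0 + (j : ℝ) • ξ)) = (j : ℝ) ^ 2 * nsq ξ := by
        simp only [nsq, Finset.mul_sum, Pi.sub_apply, Pi.add_apply, Pi.smul_apply, smul_eq_mul]
        exact Finset.sum_congr rfl (fun i _ => by ring)
      rw [e, hR, mul_pow, Real.sq_sqrt (nsq_nonneg _)]
      have := nsq_nonneg ξ
      gcongr) (by rw [htb]; linarith) (by rw [htb]; linarith)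
    linarith
  have htel : ∀ j : ℕ, j ≤ k → j * (M / 2) ≤ v (x0 + (j : ℝ) • ξ) (tb + j * σ) - v x0 tb := by
    intro j
    induction j with
    | zero => intro _; simp
    | succ n ih =>
      intro hn
      have h1 := ih (by omega)
      have h2 := hchain n (by omega)
      have e1 : x0 + ((n + 1 : ℕ) : ℝ) • ξ = x0 + (n : ℝ) • ξ + ξ := by
        push_cast; rw [add_smul, one_smul, add_assoc]
      have e2 : tb + ((n + 1 : ℕ) : ℝ) * σ = tb + n * σ + σ := by push_cast; ring
      rw [e1, e2]
      push_cast
      linarith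
  have h1 := htel k le_rfl
  have h2 := (abs_le.1 (hK (x0 + (k : ℝ) • ξ) (tb + k * σ))).2
  have h3 := (abs_le.1 (hK x0 tb)).1
  linarith

/-- All cases: bounded solutions inherit the translation invariance of the equation. -/
lemma shift_inv {N : ℕ} {A : Fin N → Fin N → (Fin N → ℝ) → ℝ}
    {b : Fin N → (Fin N → ℝ) → ℝ} {a0 Λ β : ℝ} (hcf : CF A b a0 Λ β)
    {v g : (Fin N → ℝ) → ℝ → ℝ} {K lam : ℝ}
    (hv : RegSol v) (hK : ∀ x t, |v x t| ≤ K) (hlam : 0 ≤ lam)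
    (heq : ∀ x t, deriv (fun s => v x s) t = Lop A b (fun y => v y t) x - lam * v x t + g x t)
    (ξ : Fin N → ℝ) (σ : ℝ) (hA : ∀ i j x, A i j (x + ξ) = A i j x)
    (hb : ∀ i x, b i (x + ξ) = b i x) (hg : ∀ x t, g (x + ξ) (t + σ) = g x t) :
    ∀ x t, v (x + ξ) (t + σ) = v x t := by
  have key : ∀ (ξ : Fin N → ℝ) (σ : ℝ), (∀ i j x, A i j (x + ξ) = A i j x) →
    (∀ i x, b i (x + ξ) = b i x) → (∀ x t, g (x + ξ) (t + σ) = g x t) →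
    ∀ x t, v (x + ξ) (t + σ) - v x t ≤ 0 := by
    intro ξ σ hA hb hg
    rcases hlam.eq_or_lt with h | h
    · subst h
      exact shift_le hcf hv hK heq ξ σ hA hb hg
    · exact liouville_pos hcf (v := fun x t => v (x + ξ) (t + σ) - v x t) (K := 2 * K)
        (RegSol_sub (RegSol_shift hv ξ σ) hv)
        (fun x t => by
          have := abs_sub (v (x + ξ) (t + σ)) (v x t)
          have h1 := hK (x + ξ) (t + σ)
          have h2 := hK x t
          linarith) h (shift_eq hv heq ξ σ hA hb hg)
  intro x t
  have h1 := key ξ σ hA hb hg x t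
  have h2 := key (-ξ) (-σ) (fun i j x => by rw [← hA i j (x + -ξ), neg_add_cancel_right])
    (fun i x => by rw [← hb i (x + -ξ), neg_add_cancel_right])
    (fun x t => by rw [← hg (x + -ξ) (t + -σ), neg_add_cancel_right, neg_add_cancel_right])
    (x + ξ) (t + σ)
  rw [add_neg_cancel_right, add_neg_cancel_right] at h2
  linarith

lemma per_reduce {N : ℕ} {l : Fin N → ℝ} (hl : ∀ i, 0 < l i) (x : Fin N → ℝ) :
    ∃ y ∈ Set.Icc (0 : Fin N → ℝ) l, ∀ ψ : (Fin N → ℝ) → ℝ, PerSpaceFun l ψ → ψ y = ψ x := by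
  let n : Fin N → ℤ := fun i => -⌊x i / l i⌋
  refine ⟨x + ∑ i, n i • (Pi.single i (l i) : Fin N → ℝ), ?_, ?_⟩
  · have e : ∀ j, (x + ∑ i, n i • (Pi.single i (l i) : Fin N → ℝ)) j
        = x j - ⌊x j / l j⌋ * l j := by
      intro j
      simp only [Pi.add_apply, Finset.sum_apply, Pi.smul_apply, n]
      rw [Finset.sum_eq_single j]
      · simp; ring
      · intro i _ hij
        simp [Pi.single_apply, hij.symm]
      · simp
    refine ⟨fun j => ?_, fun j => ?_⟩
    · rw [e]
      have := (le_div_iff₀ (hl j)).1 (Int.floor_le (x j / l j))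
      simp only [Pi.zero_apply]; linarith
    · rw [e]
      have := (div_lt_iff₀ (hl j)).1 (Int.lt_floor_add_one (x j / l j))
      linarith
  · intro ψ hψ
    have h : ∀ s : Finset (Fin N),
        Function.Periodic ψ (∑ i ∈ s, n i • (Pi.single i (l i) : Fin N → ℝ)) := by
      intro s
      induction s using Finset.induction_on with
      | empty => intro y; simp
      | insert a s ha ih =>
        rw [Finset.sum_insert ha]
        exact Function.Periodic.add_period (Function.Periodic.zsmul (hψ a) (n a)) ih
    exact h Finset.univ x

lemma per_bdd {N : ℕ} {l : Fin N → ℝ} (hl : ∀ i, 0 < l i) {ψ : (Fin N → ℝ) → ℝ}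
    (hc : Continuous ψ) (hp : PerSpaceFun l ψ) : ∃ M, ∀ x, |ψ x| ≤ M := by
  obtain ⟨M, hM⟩ := (isCompact_Icc (a := (0 : Fin N → ℝ)) (b := l)).exists_bound_of_continuousOn
    hc.continuousOn
  refine ⟨M, fun x => ?_⟩
  obtain ⟨y, hy, h⟩ := per_reduce hl x
  rw [← h ψ hp]
  exact hM y hy

lemma per_pos {N : ℕ} {l : Fin N → ℝ} (hl : ∀ i, 0 < l i) {ψ : (Fin N → ℝ) → ℝ}
    (hc : Continuous ψ) (hp : PerSpaceFun l ψ) (h0 : ∀ x, 0 < ψ x) :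
    ∃ c, 0 < c ∧ ∀ x, c ≤ ψ x := by
  have hne : (Set.Icc (0 : Fin N → ℝ) l).Nonempty := ⟨0, le_rfl, fun i => (hl i).le⟩
  obtain ⟨x0, _, hmin⟩ := (isCompact_Icc (a := (0 : Fin N → ℝ)) (b := l)).exists_isMinOn hne
    hc.continuousOn
  refine ⟨ψ x0, h0 x0, fun x => ?_⟩
  obtain ⟨y, hy, h⟩ := per_reduce hl x
  rw [← h ψ hp]
  exact hmin hy

/-- The drift of the operator obtained after dividing by the eigenfunction. -/
def bt {N : ℕ} (A : Fin N → Fin N → (Fin N → ℝ) → ℝ) (B : Fin N → (Fin N → ℝ) → ℝ)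
    (φ : (Fin N → ℝ) → ℝ) (i : Fin N) (x : Fin N → ℝ) : ℝ :=
  B i x + 2 * ∑ j, A i j x * (pd j φ x / φ x)

lemma pd_per {N : ℕ} {l : Fin N → ℝ} {φ : (Fin N → ℝ) → ℝ} (hp : PerSpaceFun l φ) (j : Fin N) :
    PerSpaceFun l (pd j φ) := by
  intro i x
  rw [← pd_add_right]
  congr 1
  funext y
  exact hp i y

lemma bt_per {N : ℕ} {A : Fin N → Fin N → (Fin N → ℝ) → ℝ} {B : Fin N → (Fin N → ℝ) → ℝ}
    {φ : (Fin N → ℝ) → ℝ} {l : Fin N → ℝ} (hA : ∀ i j, PerSpaceFun l (A i j))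
    (hB : ∀ i, PerSpaceFun l (B i)) (hp : PerSpaceFun l φ) (i : Fin N) :
    PerSpaceFun l (bt A B φ i) := by
  intro m x
  unfold bt
  simp only [hA _ _ m x, hB _ m x, hp m x, pd_per hp _ m x]

lemma build_CF {N : ℕ} {A : Fin N → Fin N → (Fin N → ℝ) → ℝ} {B : Fin N → (Fin N → ℝ) → ℝ}
    {C : (Fin N → ℝ) → ℝ} {φ : (Fin N → ℝ) → ℝ} {l : Fin N → ℝ} (hl : ∀ i, 0 < l i)
    (hstd : StdCoeffs (fun i j x _ => A i j x) (fun i x _ => B i x) (fun x _ => C x))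
    (hA : ∀ i j, PerSpaceFun l (A i j))
    (hB : ∀ i, PerSpaceFun l (B i)) (hφ : ContDiff ℝ 2 φ) (hφ0 : ∀ x, 0 < φ x)
    (hp : PerSpaceFun l φ) : ∃ a0 Λ β, CF A (bt A B φ) a0 Λ β := by
  obtain ⟨hAb, hAu, -, hBu, -, -, hsym, a0, a1, ha0, -, hell⟩ := hstd
  have hemb : UniformContinuous (fun x : Fin N → ℝ => (x, (0:ℝ))) :=
    uniformContinuous_id.prodMk uniformContinuous_const
  have hAu' : ∀ i j, UniformContinuous (A i j) := fun i j => (hAu i j).comp hemb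
  have hBc : ∀ i, Continuous (B i) := fun i => ((hBu i).comp hemb).continuous
  have hbc : ∀ i, Continuous (bt A B φ i) := by
    intro i
    unfold bt
    refine (hBc i).add (continuous_const.mul (continuous_finsetSum _ fun j _ => ?_))
    exact (hAu' i j).continuous.mul
      ((pd_contDiff1 hφ j).continuous.div hφ.continuous fun x => (hφ0 x).ne')
  choose Mb hMb using fun i => per_bdd hl (hbc i) (bt_per hA hB hp i)
  choose Ma hMa using hAb
  have hMb0 : ∀ i, 0 ≤ Mb i := fun i => (abs_nonneg _).trans (hMb i 0)
  have hMa0 : ∀ i j, 0 ≤ Ma i j := fun i j => (abs_nonneg _).trans (hMa i j 0 0)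
  refine ⟨a0, ∑ i, Ma i i, ∑ i, Mb i, ⟨ha0, fun i j x => hsym i j x 0, ?_, ?_, ?_, ?_, ?_, ?_⟩⟩
  · intro x ξ
    exact (hell x 0 ξ).1
  · exact Finset.sum_nonneg fun i _ => hMa0 i i
  · intro x
    exact Finset.sum_le_sum fun i _ => (le_abs_self _).trans (hMa i i x 0)
  · exact Finset.sum_nonneg fun i _ => hMb0 i
  · intro i x
    exact (hMb i x).trans (Finset.single_le_sum (fun i _ => hMb0 i) (Finset.mem_univ i))
  · intro ω hω
    have hu : UniformContinuous fun x : Fin N → ℝ => fun i j => A i j x :=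
      uniformContinuous_pi.2 fun i => uniformContinuous_pi.2 fun j => hAu' i j
    obtain ⟨δ, hδ, h⟩ := Metric.uniformContinuous_iff.1 hu ω hω
    refine ⟨δ / 2, by positivity, fun x y hxy i j => ?_⟩
    have h1 : dist x y ≤ δ / 2 := by
      refine (dist_pi_le_iff (by positivity)).2 fun m => ?_
      rw [Real.dist_eq]
      exact abs_le_of_sq_le_sq ((sq_le_nsq (x - y) m).trans hxy) (by positivity)
        |> fun h => by simpa using h
    have h2 := h (a := x) (b := y) (by linarith)
    have h3 := (dist_le_pi_dist (fun i j => A i j x) (fun i j => A i j y) i)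
    have h4 := (dist_le_pi_dist (fun j => A i j x) (fun j => A i j y) j)
    rw [Real.dist_eq] at h4
    exact h4.trans (h3.trans h2.le)

lemma pd_mul' {N : ℕ} (i : Fin N) {g h : (Fin N → ℝ) → ℝ} (x : Fin N → ℝ)
    (hg : DifferentiableAt ℝ g x) (hh : DifferentiableAt ℝ h x) :
    pd i (fun y => g y * h y) x = g x * pd i h x + h x * pd i g x := by
  unfold pd
  rw [fderiv_fun_mul hg hh]; simp

lemma pd_add' {N : ℕ} (i : Fin N) {g h : (Fin N → ℝ) → ℝ} (x : Fin N → ℝ)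
    (hg : DifferentiableAt ℝ g x) (hh : DifferentiableAt ℝ h x) :
    pd i (fun y => g y + h y) x = pd i g x + pd i h x := by
  unfold pd
  rw [fderiv_fun_add hg hh]; simp

lemma pd2_mul' {N : ℕ} (i j : Fin N) {g h : (Fin N → ℝ) → ℝ} (x : Fin N → ℝ)
    (hg : ContDiff ℝ 2 g) (hh : ContDiff ℝ 2 h) :
    pd2 i j (fun y => g y * h y) x = g x * pd2 i j h x + pd i g x * pd j h x
      + pd j g x * pd i h x + h x * pd2 i j g x := by
  unfold pd2
  have dg : Differentiable ℝ g := hg.differentiable (by norm_num)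
  have dh : Differentiable ℝ h := hh.differentiable (by norm_num)
  have dg' : Differentiable ℝ (fun y => pd j g y) := (pd_contDiff1 hg j).differentiable (by norm_num)
  have dh' : Differentiable ℝ (fun y => pd j h y) := (pd_contDiff1 hh j).differentiable (by norm_num)
  have : (fun y => pd j (fun y => g y * h y) y) = fun y => g y * pd j h y + h y * pd j g y := by
    funext y
    exact pd_mul' j y (dg y) (dh y)
  rw [this, pd_add' i x ((dg x).fun_mul (dh' x)) ((dh x).fun_mul (dg' x)), pd_mul' i x (dg x) (dh' x),
    pd_mul' i x (dh x) (dg' x)]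
  ring

/-- Product rule for the elliptic operator: `L (φ v) = φ (L̃ v) + v (L φ)`. -/
lemma Lop_mul {N : ℕ} {A : Fin N → Fin N → (Fin N → ℝ) → ℝ} {B : Fin N → (Fin N → ℝ) → ℝ}
    {φ v : (Fin N → ℝ) → ℝ} (x : Fin N → ℝ) (hsym : ∀ i j x, A i j x = A j i x)
    (hφ0 : φ x ≠ 0)
    (hφ : ContDiff ℝ 2 φ) (hv : ContDiff ℝ 2 v) :
    Lop A B (fun y => φ y * v y) x = φ x * Lop A (bt A B φ) v x + v x * Lop A B φ x := by
  have dg : DifferentiableAt ℝ φ x := hφ.differentiable (by norm_num) x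
  have dh : DifferentiableAt ℝ v x := hv.differentiable (by norm_num) x
  have e1 : ∑ i, ∑ j, A i j x * (pd j φ x * pd i v x) = ∑ i, ∑ j, A i j x * (pd i φ x * pd j v x) := by
    rw [Finset.sum_comm]
    exact Finset.sum_congr rfl fun i _ => Finset.sum_congr rfl fun j _ => by rw [hsym j i]
  have e2 : φ x * ∑ i, bt A B φ i x * pd i v x = φ x * ∑ i, B i x * pd i v x
      + 2 * ∑ i, ∑ j, A i j x * (pd j φ x * pd i v x) := by
    simp only [bt, Finset.mul_sum, ← Finset.sum_add_distrib, add_mul, Finset.sum_mul, mul_add]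
    refine Finset.sum_congr rfl fun i _ => ?_
    congr 1
    refine Finset.sum_congr rfl fun j _ => ?_
    field_simp
  unfold Lop
  rw [mul_add, e2]
  simp only [pd2_mul' _ _ x hφ hv, pd_mul' _ x dg dh, mul_add, Finset.sum_add_distrib]
  rw [e1]
  have f1 : ∑ i, ∑ j, A i j x * (φ x * pd2 i j v x) = φ x * ∑ i, ∑ j, A i j x * pd2 i j v x := by
    simp only [Finset.mul_sum]
    exact Finset.sum_congr rfl fun i _ => Finset.sum_congr rfl fun j _ => by ring
  have f2 : ∑ i, ∑ j, A i j x * (v x * pd2 i j φ x) = v x * ∑ i, ∑ j, A i j x * pd2 i j φ x := by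
    simp only [Finset.mul_sum]
    exact Finset.sum_congr rfl fun i _ => Finset.sum_congr rfl fun j _ => by ring
  have f3 : ∑ i, B i x * (φ x * pd i v x) = φ x * ∑ i, B i x * pd i v x := by
    simp only [Finset.mul_sum]
    exact Finset.sum_congr rfl fun i _ => by ring
  have f4 : ∑ i, B i x * (v x * pd i φ x) = v x * ∑ i, B i x * pd i φ x := by
    simp only [Finset.mul_sum]
    exact Finset.sum_congr rfl fun i _ => by ring
  rw [f1, f2, f3, f4]
  ring

lemma strong_max {N : ℕ} {A : Fin N → Fin N → (Fin N → ℝ) → ℝ}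
    {b : Fin N → (Fin N → ℝ) → ℝ} {a0 Λ β : ℝ} (hcf : CF A b a0 Λ β)
    {z : (Fin N → ℝ) → ℝ → ℝ} (hz : RegSol z) (hz0 : ∀ x t, 0 ≤ z x t)
    (hsup : ∀ x t, Lop A b (fun y => z y t) x ≤ deriv (fun s => z x s) t)
    {τ : ℝ} (hτ : 0 < τ) (hper : ∀ x t, z x (t + τ) = z x t)
    {x0 : Fin N → ℝ} {t0 : ℝ} (h0 : z x0 t0 = 0) : ∀ x t, z x t = 0 := by
  intro x1 t1
  by_contra hne
  have hpos : 0 < z x1 t1 := lt_of_le_of_ne (hz0 x1 t1) (Ne.symm hne)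
  obtain ⟨n, hn⟩ := exists_nat_gt ((t1 - t0 + 1) / τ)
  rw [div_lt_iff₀ hτ] at hn
  obtain ⟨t2, ht2⟩ : ∃ t2, t2 = t1 - n * τ := ⟨_, rfl⟩
  have hz2 : z x1 t2 = z x1 t1 := by
    have hp : Function.Periodic (fun s => z x1 s) τ := hper x1
    have := hp.nat_mul n t2
    rw [← this, ht2]; congr 1; ring
  have hc : Continuous fun y => z y t2 := (hz.2.2 t2).continuous
  have hev : ∀ᶠ y in 𝓝 x1, z x1 t1 / 2 < z y t2 :=
    (hc.tendsto x1).eventually (eventually_gt_nhds (by rw [hz2]; linarith))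
  obtain ⟨η, hη, hball⟩ := Metric.eventually_nhds_iff.1 hev
  obtain ⟨κ, hκ, hprop⟩ := propagate hcf (R := √(nsq (x0 - x1))) (r := η / 2) (by positivity)
  have := hprop z hz hz0 hsup x0 x1 t0 t2 (z x1 t1 / 2) (by positivity) (by linarith)
    (by rw [Real.sq_sqrt (nsq_nonneg _)]) (by
      intro x hx
      refine (hball ?_).le
      have h1 : dist x x1 ≤ η / 2 := by
        refine (dist_pi_le_iff (by positivity)).2 fun m => ?_
        rw [Real.dist_eq]
        have h := abs_le_of_sq_le_sq ((sq_le_nsq (x - x1) m).trans hx) (by positivity)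
        simpa using h
      linarith)
  rw [h0] at this
  have h2 : 0 < z x1 t1 / 2 * Real.exp (-(κ * (t0 - t2))) := by positivity
  linarith

lemma const_of_sub {N : ℕ} {A : Fin N → Fin N → (Fin N → ℝ) → ℝ}
    {b : Fin N → (Fin N → ℝ) → ℝ} {a0 Λ β : ℝ} (hcf : CF A b a0 Λ β)
    {v g : (Fin N → ℝ) → ℝ → ℝ} (hv : RegSol v)
    (heq : ∀ x t, deriv (fun s => v x s) t = Lop A b (fun y => v y t) x + g x t)
    (hg : ∀ x t, g x t ≤ 0)
    {l : Fin N → ℝ} {τ : ℝ} (hl : ∀ i, 0 < l i) (hτ : 0 < τ) (hper : PerAll l τ v) :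
    ∃ k, ∀ x t, v x t = k := by
  have hcpt : IsCompact (Set.Icc (0 : Fin N → ℝ) l ×ˢ Set.Icc (0:ℝ) τ) :=
    isCompact_Icc.prod isCompact_Icc
  have hne : (Set.Icc (0 : Fin N → ℝ) l ×ˢ Set.Icc (0:ℝ) τ).Nonempty :=
    ⟨(0, 0), ⟨le_rfl, fun i => (hl i).le⟩, le_rfl, hτ.le⟩
  obtain ⟨⟨x0, t0⟩, _, hmax⟩ := hcpt.exists_isMaxOn hne hv.1.continuousOn
  have hle : ∀ x t, v x t ≤ v x0 t0 := by
    intro x t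
    obtain ⟨y, hy, h⟩ := per_reduce hl x
    have h1 := h (fun y => v y t) (fun i x => hper.1 i x t)
    have hp : Function.Periodic (fun s => v y s) τ := hper.2 y
    obtain ⟨s, hs, h2⟩ := hp.exists_mem_Ico₀ hτ t
    rw [← h1, h2]
    exact hmax (show (y, s) ∈ _ from ⟨hy, hs.1, hs.2.le⟩)
  refine ⟨v x0 t0, fun x t => ?_⟩
  have := strong_max hcf (z := fun x t => v x0 t0 - v x t) (RegSol_sub (RegSol_const _) hv)
    (fun x t => by linarith [hle x t])
    (fun x t => by
      rw [deriv_const_sub, heq, Lop_sub' x contDiff_const (hv.2.2 t), Lop_const]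
      linarith [hg x t]) hτ (fun x t => by rw [hper.2 x t]) (x0 := x0) (t0 := t0) (sub_self _) x t
  linarith

/-- **Theorem 1.3.**  Let `P = ∂ₜ − L`, with `L` periodic with period `(l 1,…,l N)`,
and let `f` be periodic with period `(l 1,…,l N, τ)`.  If `u` is a bounded solution
of `P u = f` then: (i) if `λₚ(−L) ≥ 0` then `u` is periodic with period
`(l 1,…,l N, τ)`; (ii) if `λₚ(−L) = 0` and `f ≤ 0` or `f ≥ 0` everywhere, then
`u ≡ k φₚ` for some `k ∈ ℝ` and `f ≡ 0`; (iii) if `λₚ(−L) > 0` and `f ≡ 0` then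
`u ≡ 0`. -/
theorem thm_per {N : ℕ}
    (A : Fin N → Fin N → (Fin N → ℝ) → ℝ)
    (B : Fin N → (Fin N → ℝ) → ℝ) (C : (Fin N → ℝ) → ℝ)
    (f u : (Fin N → ℝ) → ℝ → ℝ) (l : Fin N → ℝ) (τ : ℝ)
    (hl : ∀ i, 0 < l i) (hτ : 0 < τ)
    (hstd : StdCoeffs (fun i j x _ => A i j x) (fun i x _ => B i x) (fun x _ => C x))
    (hAper : ∀ i j, PerSpaceFun l (A i j))
    (hBper : ∀ i, PerSpaceFun l (B i))
    (hCper : PerSpaceFun l C)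
    (hfper : PerAll l τ f)
    (lam : ℝ) (φp : (Fin N → ℝ) → ℝ)
    (heig : IsPerPrincipal A B C l lam φp)
    (hsol : IsSol (fun i j x _ => A i j x) (fun i x _ => B i x) (fun x _ => C x) f u)
    (hbdd : Bdd2 u) :
    (0 ≤ lam → PerAll l τ u) ∧
    (lam = 0 → ((∀ x t, f x t ≤ 0) ∨ (∀ x t, 0 ≤ f x t)) →
      (∃ k : ℝ, ∀ x t, u x t = k * φp x) ∧ (∀ x t, f x t = 0)) ∧
    (0 < lam → (∀ x t, f x t = 0) → ∀ x t, u x t = 0) := by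
  obtain ⟨hφ, hφ0, hφper, hφeq⟩ := heig
  obtain ⟨hu, hueq⟩ := hsol
  obtain ⟨Ku, hKu⟩ := hbdd
  have hsym : ∀ i j x, A i j x = A j i x := fun i j x => hstd.2.2.2.2.2.2.1 i j x 0
  obtain ⟨a0, Λ, β, hcf⟩ := build_CF hl hstd hAper hBper hφ hφ0 hφper
  obtain ⟨c, hc, hcφ⟩ := per_pos hl hφ.continuous hφper hφ0
  obtain ⟨v, hvd⟩ : ∃ v : (Fin N → ℝ) → ℝ → ℝ, ∀ x t, v x t = u x t / φp x := ⟨_, fun _ _ => rfl⟩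
  have huv : ∀ x t, u x t = φp x * v x t := fun x t => by
    rw [hvd, mul_div_cancel₀ _ (hφ0 x).ne']
  have hv : RegSol v := by
    have e : v = fun x t => u x t / φp x := by funext x t; exact hvd x t
    rw [e]
    refine ⟨hu.1.div (hφ.continuous.comp continuous_fst) fun p => (hφ0 p.1).ne', fun x => ?_,
      fun t => (hu.2.2 t).div hφ fun x => (hφ0 x).ne'⟩
    exact (hu.2.1 x).div_const _
  have hKu0 : 0 ≤ Ku := (abs_nonneg _).trans (hKu 0 0)
  have hKv : ∀ x t, |v x t| ≤ Ku / c := fun x t => by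
    rw [hvd, abs_div, abs_of_pos (hφ0 x)]
    exact div_le_div₀ hKu0 (hKu x t) hc (hcφ x)
  have hveq : ∀ x t, deriv (fun s => v x s) t
      = Lop A (bt A B φp) (fun y => v y t) x - lam * v x t + f x t / φp x := by
    intro x t
    have h1 := hueq x t
    unfold parOp at h1
    have hd : deriv (fun s => u x s) t = φp x * deriv (fun s => v x s) t := by
      simp only [huv]
      exact deriv_const_mul _ (hv.2.1 x t)
    have hL := Lop_mul (A := A) (B := B) x hsym (hφ0 x).ne' hφ (hv.2.2 t)
    have e : (fun y => φp y * v y t) = fun y => u y t := by funext y; exact (huv y t).symm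
    rw [e] at hL
    have h2 := hφeq x
    unfold ellOp at h2
    have hL2 : Lop A B φp x = -lam * φp x - C x * φp x := by
      unfold Lop; linarith
    rw [hL2] at hL
    unfold Lop at hL
    rw [hd, huv x t] at h1
    have h3 : φp x * deriv (fun s => v x s) t
        = φp x * Lop A (bt A B φp) (fun y => v y t) x - lam * (φp x * v x t) + f x t := by
      unfold Lop
      linarith
    have hne := (hφ0 x).ne'
    apply mul_left_cancel₀ hne
    rw [h3]
    field_simp
  have hbper := bt_per hAper hBper hφper
  have hvper : 0 ≤ lam → PerAll l τ v := by
    intro hlam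
    refine ⟨fun i x t => ?_, fun x t => ?_⟩
    · have := shift_inv hcf (g := fun x t => f x t / φp x) hv hKv hlam hveq (Pi.single i (l i)) 0
        (fun m j x => hAper m j i x) (fun m x => hbper m i x)
        (fun x t => by simp only [add_zero]; rw [hfper.1 i x t, hφper i x]) x t
      rwa [add_zero] at this
    · have := shift_inv hcf (g := fun x t => f x t / φp x) hv hKv hlam hveq 0 τ
        (fun m j x => by rw [add_zero]) (fun m x => by rw [add_zero])
        (fun x t => by simp only [add_zero]; rw [hfper.2 x t]) x t
      rwa [add_zero] at this
  refine ⟨fun hlam => ?_, fun hlam hf => ?_, fun hlam hf => ?_⟩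
  · obtain ⟨h1, h2⟩ := hvper hlam
    exact ⟨fun i x t => by rw [huv, huv, h1, hφper i x], fun x t => by rw [huv, huv, h2]⟩
  · subst hlam
    have hp := hvper le_rfl
    have hveq' : ∀ x t, deriv (fun s => v x s) t
        = Lop A (bt A B φp) (fun y => v y t) x + f x t / φp x := fun x t => by
      rw [hveq]; ring
    obtain ⟨k, hk⟩ : ∃ k, ∀ x t, v x t = k := by
      rcases hf with hf | hf
      · exact const_of_sub hcf hv hveq'
          (fun x t => div_nonpos_of_nonpos_of_nonneg (hf x t) (hφ0 x).le) hl hτ hp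
      · obtain ⟨k, hk⟩ := const_of_sub hcf (v := fun x t => - v x t)
          (g := fun x t => - (f x t / φp x))
          ⟨hv.1.neg, fun x => (hv.2.1 x).neg, fun t => (hv.2.2 t).neg⟩
          (fun x t => by
            rw [deriv.fun_neg, hveq', Lop_neg]
            ring)
          (fun x t => neg_nonpos.2 (div_nonneg (hf x t) (hφ0 x).le)) hl hτ
          ⟨fun i x t => congrArg Neg.neg (hp.1 i x t), fun x t => congrArg Neg.neg (hp.2 x t)⟩
        exact ⟨-k, fun x t => by rw [← hk x t, neg_neg]⟩
    refine ⟨⟨k, fun x t => by rw [huv, hk, mul_comm]⟩, fun x t => ?_⟩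
    have h1 := hveq' x t
    simp only [hk, Lop_const, deriv_const, zero_add] at h1
    have := (div_eq_zero_iff.1 h1.symm).resolve_right (hφ0 x).ne'
    exact this
  · have hveq' : ∀ x t, deriv (fun s => v x s) t
        = Lop A (bt A B φp) (fun y => v y t) x - lam * v x t := fun x t => by
      rw [hveq, hf]; simp
    intro x t
    have h1 := liouville_pos hcf hv hKv hlam hveq' x t
    have h2 := liouville_pos hcf (v := fun x t => - v x t) (K := Ku / c)
      ⟨hv.1.neg, fun x => (hv.2.1 x).neg, fun t => (hv.2.2 t).neg⟩
      (fun x t => by rw [abs_neg]; exact hKv x t) hlam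
      (fun x t => by
        rw [deriv.fun_neg, hveq', Lop_neg]
        ring) x t
    have : v x t = 0 := by linarith
    rw [huv, this, mul_zero]
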